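/- Let R be a CGL extension of length N over an infinite field K, with n, μ, and y₁,…,y_N as produced by the structure theorem for CGL extensions, and let Δ(R) := {(m₁,…,m_N) ∈ ℤ≥0^N : for every i ∈ {1,…,n} there exists k with μ(k) = i and m_k = 0}. Then R = ⊕_{g ∈ Δ(R)} N(R)·x^g = ⊕_{g ∈ Δ(R)} x^g·N(R), where x^g := x₁^{g₁}⋯x_N^{g_N}; that is, the monomials {x^g : g ∈ Δ(R)} form a basis of R both as a free left N(R)-module and as a free right N(R)-module. In particular, R is a free left and right module over its normal subalgebra N(R), and N(R) (the summand corresponding to g = 0) is an (N(R),N(R))-bimodule direct summand of R. -/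

import Mathlib

section CGLDefs

/-- `tᵐ = t₁^{m₁} ⋯ t_r^{m_r}` for a torus element `t ∈ (Kˣ)ʳ` and a character
`m ∈ ℤʳ`. -/
def tpow {K : Type*} [Field K] {r : ℕ} (t : Fin r → Kˣ) (m : Fin r → ℤ) : Kˣ :=
  ∏ i, t i ^ m i

/-- The ordered monomial `x^f = x₁^{f₁} ⋯ x_N^{f_N}`. -/
def xmon {R : Type*} [Ring R] {N : ℕ} (x : Fin N → R) (f : Fin N → ℕ) : R :=
  ((List.finRange N).map fun i => x i ^ f i).prod

/-- `u` is a normal element of `R`: `uR = Ru`. -/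
def IsNormalElem {R : Type*} [Ring R] (u : R) : Prop :=
  {y : R | ∃ t : R, y = u * t} = {y : R | ∃ t : R, y = t * u}

/-- `u` is normal in the subset `S` (a subalgebra): `uS = Su`. -/
def NormalIn {R : Type*} [Ring R] (S : Set R) (u : R) : Prop :=
  {y : R | ∃ b ∈ S, y = u * b} = {y : R | ∃ b ∈ S, y = b * u}

/-- `u ∣ a` within `S`: `a ∈ Su`. -/
def DvdIn {R : Type*} [Ring R] (S : Set R) (u a : R) : Prop :=
  ∃ b ∈ S, a = b * u

/-- `u` is a prime element of the subring corresponding to the subset `S`: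
`u ∈ S` is nonzero, normal in `S`, and generates a proper completely prime
ideal of `S`. -/
def IsPrimeElemIn {R : Type*} [Ring R] (S : Set R) (u : R) : Prop :=
  u ∈ S ∧ u ≠ 0 ∧ NormalIn S u ∧ ¬ DvdIn S u 1 ∧
    ∀ a ∈ S, ∀ b ∈ S, DvdIn S u (a * b) → DvdIn S u a ∨ DvdIn S u b

/-- The data of a CGL extension presentation of length `N` and torus rank `r`:
generators `x₁,…,x_N`, a `ℤʳ`-grading `A` of `R` (encoding the rational torus
action), the degrees `ρ j` of the generators, and the torus elements `h k`. -/
structure CGLData (K : Type*) [Field K] (R : Type*) [Ring R] [Algebra K R]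
    (N r : ℕ) where
  x : Fin N → R
  A : (Fin r → ℤ) → Submodule K R
  graded : GradedAlgebra A
  ρ : Fin N → Fin r → ℤ
  h : Fin N → Fin r → Kˣ

variable {K : Type*} [Field K] {R : Type*} [Ring R] [Algebra K R] {N r : ℕ}

/-- The action of the torus element `t ∈ (Kˣ)ʳ` on `R`: `t` acts on the
homogeneous component of degree `m` by the scalar `tᵐ`. -/
noncomputable def CGLData.act (E : CGLData K R N r) (t : Fin r → Kˣ)
    (a : R) : R :=
  letI := E.graded
  letI : ∀ (m : Fin r → ℤ) (z : ↥(E.A m)), Decidable (z ≠ 0) :=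
    fun _ _ => Classical.dec _
  (DirectSum.decompose E.A a).sum fun m z => ((tpow t m : Kˣ) : K) • (z : R)

/-- The subalgebra `R_k` generated by `x_j` for `j < k` (so `R₀ = K` and
`R_N = R`). -/
def CGLData.sub (E : CGLData K R N r) (k : ℕ) : Subalgebra K R :=
  Algebra.adjoin K {y : R | ∃ j : Fin N, (j : ℕ) < k ∧ y = E.x j}

/-- The skew derivation `δ_k(b) = x_k·b − σ_k(b)·x_k`, where
`σ_k = (h_k ·)`. -/
noncomputable def CGLData.D (E : CGLData K R N r) (k : Fin N) (a : R) : R :=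
  E.x k * a - E.act (E.h k) a * E.x k

/-- The conditions making the data `E` a CGL extension presentation:
the ordered monomials in the `x_i` form a `K`-basis of `R` (PBW);
each `x_i` is a nonzero homogeneous element of degree `ρ i`;
for each `k`, `σ_k := (h_k ·)` and `δ_k` map `R_{k-1}` to itself (so that
`R_k = R_{k-1}[x_k; σ_k, δ_k]`, with `σ_k(x_j) = λ_{kj} x_j` for
`λ_{kj} := h_k^{ρ j}` automatically);
each `δ_k` is locally nilpotent on `R_{k-1}`;
and `λ_k := h_k^{ρ k}` is not a root of unity. -/
structure CGLData.IsCGL (E : CGLData K R N r) : Prop where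
  pbw : ∀ a : R, ∃! c : (Fin N → ℕ) →₀ K, a = c.sum fun f t => t • xmon E.x f
  xhom : ∀ i : Fin N, E.x i ∈ E.A (E.ρ i)
  xne : ∀ i : Fin N, E.x i ≠ 0
  sigma_stab : ∀ k : Fin N, ∀ b ∈ E.sub (k : ℕ), E.act (E.h k) b ∈ E.sub (k : ℕ)
  delta_stab : ∀ k : Fin N, ∀ b ∈ E.sub (k : ℕ), E.D k b ∈ E.sub (k : ℕ)
  delta_nil : ∀ k : Fin N, ∀ b ∈ E.sub (k : ℕ), ∃ n : ℕ, (E.D k)^[n] b = 0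
  notroot : ∀ k : Fin N, ∀ n : ℕ, 1 ≤ n → (tpow (E.h k) (E.ρ k)) ^ n ≠ 1

/-- `u` is a homogeneous prime element of the subalgebra of `R` given by the
subset `S`, for the grading of the CGL datum `E`. -/
def CGLData.IsHomogPrimeIn (E : CGLData K R N r) (S : Set R) (u : R) : Prop :=
  IsPrimeElemIn S u ∧ ∃ m : Fin r → ℤ, u ∈ E.A m

/-- `s(j) > k` for the level sets of `μ`: there is no `j'` with
`j < j' ≤ k` and `μ(j') = μ(j)`. -/
def SGt {N n : ℕ} (μ : Fin N → Fin n) (j k : Fin N) : Prop :=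
  ∀ j' : Fin N, j < j' → j' ≤ k → μ j' ≠ μ j

/-- `s(j) = +∞` for the level sets of `μ`. -/
def SInf {N n : ℕ} (μ : Fin N → Fin n) (j : Fin N) : Prop :=
  ∀ j' : Fin N, j < j' → μ j' ≠ μ j

/-- `p(k) = −∞` for the level sets of `μ`. -/
def PInf {N n : ℕ} (μ : Fin N → Fin n) (k : Fin N) : Prop :=
  ∀ j : Fin N, j < k → μ j ≠ μ k

/-- `p(k) = j` for the level sets of `μ`. -/
def IsPred {N n : ℕ} (μ : Fin N → Fin n) (j k : Fin N) : Prop :=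
  j < k ∧ μ j = μ k ∧ ∀ j' : Fin N, j < j' → j' < k → μ j' ≠ μ k

/-- The multiplicatively skewsymmetric extension of the matrix
`λ_{km} = h_k^{ρ m}` (for `m < k`). -/
def CGLData.lam (E : CGLData K R N r) (k m : Fin N) : Kˣ :=
  if m < k then tpow (E.h k) (E.ρ m)
  else if k < m then (tpow (E.h m) (E.ρ k))⁻¹
  else 1

/-- The scalars `α_{kj} = ∏_{m=0}^{O₋(j)} λ_{k,p^m(j)}`; the iterates
`p^m(j)` run exactly over `{i ≤ j : μ(i) = μ(j)}`. -/
def CGLData.alpha (E : CGLData K R N r) {n : ℕ} (μ : Fin N → Fin n)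
    (k j : Fin N) : Kˣ :=
  ∏ m ∈ Finset.univ.filter fun m : Fin N => m ≤ j ∧ μ m = μ j, E.lam k m

/-- The scalars
`q_{kj} = ∏_{i=0}^{O₋(k)} ∏_{m=0}^{O₋(j)} λ_{p^i(k),p^m(j)}`; the iterates
`p^i(k)` run exactly over `{i ≤ k : μ(i) = μ(k)}`. -/
def CGLData.q (E : CGLData K R N r) {n : ℕ} (μ : Fin N → Fin n)
    (k j : Fin N) : Kˣ :=
  ∏ i ∈ Finset.univ.filter fun i : Fin N => i ≤ k ∧ μ i = μ k,
    ∏ m ∈ Finset.univ.filter fun m : Fin N => m ≤ j ∧ μ m = μ j, E.lam i m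

end CGLDefs

section Struct

variable {K : Type*} [Field K] {R : Type*} [Ring R] [Algebra K R] {N r : ℕ}

/-- The data `(μ, d, y)` produced by the structure theorem for the CGL
extension `E`: `μ` is surjective, the `y_k` are defined by the recursion
`y_k = y_{p(k)}·x_k − d_k` (with `y_k = x_k` when `p(k) = −∞`), each `y_k` is
homogeneous, `{y_j : j ≤ k, s(j) > k}` is a complete irredundant list (up to
scalar multiples) of the homogeneous prime elements of `R_k`, and
`y_k·y_j = q_{kj}·y_j·y_k`. -/
def CGLData.StructData (E : CGLData K R N r) {n : ℕ} (μ : Fin N → Fin n)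
    (d y : Fin N → R) : Prop :=
  Function.Surjective μ ∧
  (∀ k : Fin N, PInf μ k → y k = E.x k) ∧
  (∀ k j : Fin N, IsPred μ j k →
    d k ∈ E.sub (k : ℕ) ∧ y k = y j * E.x k - d k) ∧
  (∀ k : Fin N, ∃ m : Fin r → ℤ, y k ∈ E.A m) ∧
  (∀ k : Fin N,
    (∀ j : Fin N, j ≤ k → SGt μ j k →
      E.IsHomogPrimeIn (E.sub ((k : ℕ) + 1) : Set R) (y j)) ∧
    (∀ j j' : Fin N, j ≤ k → j' ≤ k → SGt μ j k → SGt μ j' k → j ≠ j' →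
      ∀ t : Kˣ, y j ≠ (t : K) • y j') ∧
    (∀ p : R, E.IsHomogPrimeIn (E.sub ((k : ℕ) + 1) : Set R) p →
      ∃ j : Fin N, j ≤ k ∧ SGt μ j k ∧ ∃ t : Kˣ, p = (t : K) • y j)) ∧
  (∀ k j : Fin N, y k * y j = ((E.q μ k j : Kˣ) : K) • (y j * y k))

end Struct

/-! ### The colexicographic order on exponents -/

/-- The strict colexicographic order on exponent vectors. -/
def ColexLT {N : ℕ} (f g : Fin N → ℕ) : Prop :=
  ∃ k, f k < g k ∧ ∀ j, k < j → f j = g j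

namespace ColexLT

variable {N : ℕ} {f g h : Fin N → ℕ}

theorem trans (h₁ : ColexLT f g) (h₂ : ColexLT g h) : ColexLT f h := by
  obtain ⟨k, hk, hk'⟩ := h₁
  obtain ⟨l, hl, hl'⟩ := h₂
  rcases lt_trichotomy k l with hkl | rfl | hkl
  · exact ⟨l, by rw [hk' l hkl]; exact hl, fun j hj => by
      rw [hk' j (hkl.trans hj), hl' j hj]⟩
  · exact ⟨k, hk.trans hl, fun j hj => by rw [hk' j hj, hl' j hj]⟩
  · exact ⟨k, by rw [← hl' k hkl]; exact hk, fun j hj => by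
      rw [hk' j hj, hl' j (hkl.trans hj)]⟩

theorem irrefl (f : Fin N → ℕ) : ¬ ColexLT f f := fun ⟨_, hk, _⟩ => lt_irrefl _ hk

theorem add_right (h₁ : ColexLT f g) (h : Fin N → ℕ) : ColexLT (f + h) (g + h) := by
  obtain ⟨k, hk, hk'⟩ := h₁
  exact ⟨k, by simpa using hk, fun j hj => by simp [hk' j hj]⟩

theorem add_left (h₁ : ColexLT f g) (h : Fin N → ℕ) : ColexLT (h + f) (h + g) := by
  rw [add_comm h f, add_comm h g]
  exact h₁.add_right h

theorem lt_or_gt (hne : f ≠ g) : ColexLT f g ∨ ColexLT g f := by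
  have hs : (Finset.univ.filter fun k => f k ≠ g k).Nonempty := by
    obtain ⟨k, hk⟩ := Function.ne_iff.mp hne
    exact ⟨k, by simpa using hk⟩
  set k := Finset.max' _ hs with hk
  have hmem : f k ≠ g k := by simpa using Finset.max'_mem _ hs
  have hab : ∀ j, k < j → f j = g j := fun j hj => by
    by_contra hfg
    exact absurd (Finset.le_max' _ j (by simpa using hfg)) (not_le.mpr hj)
  rcases lt_or_gt_of_ne hmem with hlt | hlt
  · exact Or.inl ⟨k, hlt, hab⟩
  · exact Or.inr ⟨k, hlt, fun j hj => (hab j hj).symm⟩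

theorem wellFounded (N : ℕ) : WellFounded (@ColexLT N) := by
  have h := Pi.Lex.wellFounded (ι := Fin N) (α := fun _ => ℕ) (fun a b : Fin N => b < a)
    (s := fun _ => (· < ·)) (fun _ => wellFounded_lt)
  refine Subrelation.wf ?_ h
  rintro f g ⟨k, hk, hk'⟩
  exact ⟨k, fun j hj => hk' j hj, hk⟩

/-- An exponent below one supported on the first `k` indices is supported there too. -/
theorem eq_zero_of_le (h₁ : ColexLT f g) {k : ℕ} (hg : ∀ j : Fin N, k ≤ j → g j = 0)
    (j : Fin N) (hj : k ≤ j) : f j = 0 := by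
  obtain ⟨l, hl, hl'⟩ := h₁
  have hlk : (l : ℕ) < k := by
    by_contra hkl
    rw [hg l (not_lt.mp hkl)] at hl
    exact Nat.not_lt_zero _ hl
  rw [hl' j (Fin.lt_def.mpr (hlk.trans_le hj)), hg j hj]

end ColexLT

/-! ### Ordered monomials -/

section Monomials

variable {R : Type*} [Ring R] {N : ℕ}

theorem list_prod_pow_split (z : Fin N → R) (k : Fin N) (f : Fin N → ℕ)
    (hf : ∀ j, k < j → f j = 0) (l : List (Fin N)) (hl : l.Pairwise (· < ·)) (hk : k ∈ l) :
    (l.map fun i => z i ^ f i).prod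
      = (l.map fun i => z i ^ Function.update f k 0 i).prod * z k ^ f k := by
  induction l with
  | nil => simp at hk
  | cons a t ih =>
    rw [List.pairwise_cons] at hl
    by_cases hak : a = k
    · subst hak
      have h1 : (t.map fun i => z i ^ f i).prod = 1 := by
        refine List.prod_eq_one fun w hw => ?_
        obtain ⟨i, hi, rfl⟩ := List.mem_map.mp hw
        rw [hf i (hl.1 i hi), pow_zero]
      have h2 : (t.map fun i => z i ^ Function.update f a 0 i).prod = 1 := by
        refine List.prod_eq_one fun w hw => ?_
        obtain ⟨i, hi, rfl⟩ := List.mem_map.mp hw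
        rw [Function.update_of_ne (hl.1 i hi).ne', hf i (hl.1 i hi), pow_zero]
      simp [h1, h2]
    · have hkt : k ∈ t := by
        rcases List.mem_cons.mp hk with h | h
        · exact absurd h.symm hak
        · exact h
      rw [List.map_cons, List.prod_cons, List.map_cons, List.prod_cons, ih hl.2 hkt,
        Function.update_of_ne hak, mul_assoc]

theorem xmon_split (z : Fin N → R) (k : Fin N) (f : Fin N → ℕ) (hf : ∀ j, k < j → f j = 0) :
    xmon z f = xmon z (Function.update f k 0) * z k ^ f k :=
  list_prod_pow_split z k f hf _ (List.pairwise_lt_finRange N) (List.mem_finRange k)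

theorem xmon_mul_pow (z : Fin N → R) (k : Fin N) (f : Fin N → ℕ)
    (hf : ∀ j : Fin N, (k : ℕ) ≤ j → f j = 0) (i : ℕ) :
    xmon z f * z k ^ i = xmon z (Function.update f k i) := by
  rw [xmon_split z k (Function.update f k i), Function.update_idem, Function.update_self]
  · rw [← hf k le_rfl, Function.update_eq_self]
  · intro j hj
    rw [Function.update_of_ne hj.ne']
    exact hf j (Fin.le_def.mp hj.le)

theorem xmon_zero (z : Fin N → R) : xmon z 0 = 1 :=
  List.prod_eq_one fun w hw => by
    obtain ⟨i, _, rfl⟩ := List.mem_map.mp hw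
    simp

theorem xmon_mem {S : Type*} [SetLike S R] [SubmonoidClass S R] (s : S) (z : Fin N → R)
    (f : Fin N → ℕ) (h : ∀ i, f i ≠ 0 → z i ∈ s) : xmon z f ∈ s := by
  refine list_prod_mem fun w hw => ?_
  obtain ⟨i, _, rfl⟩ := List.mem_map.mp hw
  by_cases hi : f i = 0
  · rw [hi, pow_zero]
    exact one_mem s
  · exact pow_mem (h i hi) _

end Monomials

/-! ### Leading exponents -/

section Lead

variable {K : Type*} [Field K] {R : Type*} [Ring R] [Algebra K R] {N : ℕ}

/-- The span of the monomials that are strictly below `x^f`. -/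
def lowerSpan (K : Type*) [Field K] {R : Type*} [Ring R] [Algebra K R] {N : ℕ}
    (x : Fin N → R) (f : Fin N → ℕ) : Submodule K R :=
  Submodule.span K (xmon x '' {g | ColexLT g f})

/-- `a` is a nonzero multiple of `x^f` plus strictly lower monomials. -/
def HasLead (K : Type*) [Field K] {R : Type*} [Ring R] [Algebra K R] {N : ℕ}
    (x : Fin N → R) (a : R) (f : Fin N → ℕ) : Prop :=
  ∃ c : K, c ≠ 0 ∧ ∃ l ∈ lowerSpan K x f, a = c • xmon x f + l

variable {x : Fin N → R} {a b : R} {f g : Fin N → ℕ}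

theorem xmon_mem_lowerSpan (h : ColexLT f g) : xmon x f ∈ lowerSpan K x g :=
  Submodule.subset_span ⟨f, h, rfl⟩

theorem lowerSpan_mono (h : ColexLT f g) : lowerSpan K x f ≤ lowerSpan K x g :=
  Submodule.span_mono (Set.image_mono fun _ hh => ColexLT.trans hh h)

theorem hasLead_xmon (x : Fin N → R) (f : Fin N → ℕ) : HasLead K x (xmon x f) f :=
  ⟨1, one_ne_zero, 0, zero_mem _, by simp⟩

theorem HasLead.mem_lowerSpan (h : HasLead K x a f) (hfg : ColexLT f g) :
    a ∈ lowerSpan K x g := by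
  obtain ⟨c, _, l, hl, rfl⟩ := h
  exact add_mem (Submodule.smul_mem _ _ (xmon_mem_lowerSpan hfg)) (lowerSpan_mono hfg hl)

theorem HasLead.add_mem_lowerSpan (h : HasLead K x a f) (hb : b ∈ lowerSpan K x f) :
    HasLead K x (a + b) f := by
  obtain ⟨c, hc, l, hl, rfl⟩ := h
  exact ⟨c, hc, l + b, add_mem hl hb, by rw [add_assoc]⟩

theorem HasLead.smul (h : HasLead K x a f) {t : K} (ht : t ≠ 0) : HasLead K x (t • a) f := by
  obtain ⟨c, hc, l, hl, rfl⟩ := h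
  exact ⟨t * c, mul_ne_zero ht hc, t • l, Submodule.smul_mem _ _ hl, by
    rw [smul_add, smul_smul]⟩

theorem HasLead.sum {ι : Type*} {v : ι → R} {e : ι → Fin N → ℕ} {s : Finset ι}
    (hs : s.Nonempty) (hv : ∀ i ∈ s, HasLead K x (v i) (e i)) (he : Set.InjOn e s) :
    ∃ i ∈ s, HasLead K x (∑ j ∈ s, v j) (e i) := by
  classical
  induction hs using Finset.Nonempty.cons_induction with
  | singleton i => exact ⟨i, by simp, by simpa using hv i (by simp)⟩
  | cons i s hi hs ih =>
    obtain ⟨j, hj, hj'⟩ := ih (fun j hj => hv j (by simp [hj]))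
      (he.mono (by simp))
    have hij : e i ≠ e j := fun h => by
      have := he (by simp) (by simp [hj]) h
      exact hi (this ▸ hj)
    rw [Finset.sum_cons]
    rcases ColexLT.lt_or_gt hij with h | h
    · refine ⟨j, by simp [hj], ?_⟩
      rw [add_comm]
      exact hj'.add_mem_lowerSpan ((hv i (by simp)).mem_lowerSpan h)
    · exact ⟨i, by simp, (hv i (by simp)).add_mem_lowerSpan (hj'.mem_lowerSpan h)⟩

section Independent

variable (hx : LinearIndependent K (xmon x))

include hx

theorem xmon_notMem_lowerSpan (f : Fin N → ℕ) : xmon x f ∉ lowerSpan K x f :=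
  hx.notMem_span_image (ColexLT.irrefl f)

theorem HasLead.notMem_lowerSpan (h : HasLead K x a f) : a ∉ lowerSpan K x f := by
  obtain ⟨c, hc, l, hl, rfl⟩ := h
  intro hmem
  have h1 := (Submodule.smul_mem_iff _ hc).mp ((Submodule.add_mem_iff_left _ hl).mp hmem)
  exact xmon_notMem_lowerSpan hx f h1

theorem HasLead.ne_zero (h : HasLead K x a f) : a ≠ 0 := by
  rintro rfl
  exact h.notMem_lowerSpan hx (zero_mem _)

theorem HasLead.unique (h : HasLead K x a f) (h' : HasLead K x a g) : f = g := by
  by_contra hne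
  rcases ColexLT.lt_or_gt hne with hlt | hlt
  · exact h'.notMem_lowerSpan hx (h.mem_lowerSpan hlt)
  · exact h.notMem_lowerSpan hx (h'.mem_lowerSpan hlt)

end Independent

theorem exists_hasLead_of_mem_span {s : Set (Fin N → ℕ)} (ha : a ∈ Submodule.span K (xmon x '' s))
    (h0 : a ≠ 0) : ∃ f ∈ s, HasLead K x a f := by
  classical
  rw [Finsupp.mem_span_image_iff_linearCombination] at ha
  obtain ⟨c, hc, rfl⟩ := ha
  have hne : c.support.Nonempty := by
    rw [Finsupp.support_nonempty_iff]
    rintro rfl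
    simp at h0
  obtain ⟨i, hi, hi'⟩ := HasLead.sum (K := K) (x := x) (v := fun f => c f • xmon x f) (e := id)
    hne (fun f hf => (hasLead_xmon x f).smul (by simpa using hf)) Function.injective_id.injOn
  exact ⟨i, hc hi, by simpa [Finsupp.linearCombination_apply, Finsupp.sum] using hi'⟩

end Lead

/-! ### The grading of a CGL datum -/

theorem tpow_add {K : Type*} [Field K] {r : ℕ} (t : Fin r → Kˣ) (m m' : Fin r → ℤ) :
    tpow t (m + m') = tpow t m * tpow t m' := by
  simp [tpow, zpow_add, Finset.prod_mul_distrib]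

theorem tpow_nsmul {K : Type*} [Field K] {r : ℕ} (t : Fin r → Kˣ) (m : Fin r → ℤ) (i : ℕ) :
    tpow t (i • m) = tpow t m ^ i := by
  induction i with
  | zero => simp [tpow]
  | succ i ih => rw [succ_nsmul, tpow_add, ih, pow_succ]

namespace CGLData

variable {K : Type*} [Field K] {R : Type*} [Ring R] [Algebra K R] {N r : ℕ}
  (E : CGLData K R N r)

/-- The projection onto the homogeneous component of degree `m`. -/
noncomputable def proj (m : Fin r → ℤ) : R →ₗ[K] R :=
  letI := E.graded
  GradedAlgebra.proj E.A m

variable {E} {a b : R} {m m' : Fin r → ℤ}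

theorem proj_mem (a : R) : E.proj m a ∈ E.A m := by
  let := E.graded
  exact SetLike.coe_mem _

theorem proj_of_mem (h : a ∈ E.A m) : E.proj m a = a := by
  let := E.graded
  exact DirectSum.decompose_of_mem_same E.A h

theorem proj_of_mem_ne (h : a ∈ E.A m) (hne : m ≠ m') : E.proj m' a = 0 := by
  let := E.graded
  exact DirectSum.decompose_of_mem_ne E.A h hne

theorem exists_sum_proj (E : CGLData K R N r) (a : R) :
    ∃ s : Finset (Fin r → ℤ), (∀ m, m ∈ s ↔ E.proj m a ≠ 0) ∧ a = ∑ m ∈ s, E.proj m a := by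
  classical
  let := E.graded
  refine ⟨(DirectSum.decompose E.A a).support, fun m => ?_, ?_⟩
  · rw [DFinsupp.mem_support_iff, Ne, Ne, ← Subtype.coe_inj]
    rfl
  · exact (DirectSum.sum_support_decompose E.A a).symm

theorem proj_mul_right (hb : b ∈ E.A m') (a : R) :
    E.proj (m + m') (a * b) = E.proj m a * b := by
  let := E.graded
  exact DirectSum.coe_decompose_mul_add_of_right_mem E.A hb

theorem proj_mul_left (ha : a ∈ E.A m) (b : R) :
    E.proj (m + m') (a * b) = a * E.proj m' b := by
  let := E.graded
  exact DirectSum.coe_decompose_mul_add_of_left_mem E.A ha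

theorem mul_mem_A (ha : a ∈ E.A m) (hb : b ∈ E.A m') : a * b ∈ E.A (m + m') := by
  let := E.graded
  exact SetLike.mul_mem_graded ha hb

theorem one_mem_A : (1 : R) ∈ E.A 0 := by
  let := E.graded
  exact SetLike.one_mem_graded E.A

theorem pow_mem_A (ha : a ∈ E.A m) (i : ℕ) : a ^ i ∈ E.A (i • m) := by
  let := E.graded
  exact SetLike.pow_mem_graded i ha

theorem act_of_mem (t : Fin r → Kˣ) (h : a ∈ E.A m) :
    E.act t a = ((tpow t m : Kˣ) : K) • a := by
  let := E.graded
  let : ∀ (m : Fin r → ℤ) (z : ↥(E.A m)), Decidable (z ≠ 0) := fun _ _ => Classical.dec _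
  unfold act
  rw [DirectSum.decompose_of_mem E.A h]
  exact (DFinsupp.sum_single_index (by simp))

theorem xmon_homogeneous {z : Fin N → R} (hz : ∀ i, ∃ m, z i ∈ E.A m) (f : Fin N → ℕ) :
    ∃ m, xmon z f ∈ E.A m := by
  let := E.graded
  have := xmon_mem (SetLike.homogeneousSubmonoid E.A) z f fun i _ => hz i
  exact this

/-- If the maximal degrees of `a` and `b` with respect to a linear order are `s` and `t`, the
component of `a * b` of degree `s + t` is the product of the extreme components. -/
theorem proj_mul_of_max {Γ : Type*} [AddCommGroup Γ] [LinearOrder Γ] [IsOrderedAddMonoid Γ]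
    (φ : (Fin r → ℤ) →+ Γ) (hφ : Function.Injective φ)
    (ha : ∀ s, E.proj s a ≠ 0 → φ s ≤ φ m) (hb : ∀ t, E.proj t b ≠ 0 → φ t ≤ φ m') :
    E.proj (m + m') (a * b) = E.proj m a * E.proj m' b := by
  classical
  let := E.graded
  have h : E.proj (m + m') (a * b) =
      ∑ ij ∈ (DirectSum.decompose E.A a).support ×ˢ (DirectSum.decompose E.A b).support with
        ij.1 + ij.2 = m + m', (E.proj ij.1 a * E.proj ij.2 b) := by
    have := DirectSum.coe_mul_apply E.A (DirectSum.decompose E.A a) (DirectSum.decompose E.A b)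
      (m + m')
    rw [← DirectSum.decompose_mul] at this
    exact this
  have hmem : ∀ (c : R) (s : Fin r → ℤ), s ∈ (DirectSum.decompose E.A c).support ↔
      E.proj s c ≠ 0 := fun c s => by
    rw [DFinsupp.mem_support_iff, Ne, Ne, ← Subtype.coe_inj]
    rfl
  rw [h]
  refine Finset.sum_eq_single (m, m') ?_ ?_
  · rintro ⟨s, t⟩ hst hne
    simp only [Finset.mem_filter, Finset.mem_product, hmem] at hst
    obtain ⟨⟨hs, ht⟩, hst⟩ := hst
    have h1 := ha s hs
    have h2 := hb t ht
    have h3 : φ s + φ t = φ m + φ m' := by rw [← map_add, hst, map_add]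
    have h4 : φ s = φ m := le_antisymm h1 (by
      by_contra hlt
      exact (add_lt_add_of_lt_of_le (not_le.mp hlt) h2).ne h3)
    have h5 := hφ h4
    subst h5
    exact absurd (by rw [add_left_cancel hst]) hne
  · intro hn
    simp only [Finset.mem_filter, Finset.mem_product, hmem, and_true, not_and_or, not_not] at hn
    rcases hn with hn | hn <;> simp [hn]

theorem exists_max_degree {Γ : Type*} [LinearOrder Γ] (φ : (Fin r → ℤ) → Γ) (ha : a ≠ 0) :
    ∃ m, E.proj m a ≠ 0 ∧ ∀ s, E.proj s a ≠ 0 → φ s ≤ φ m := by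
  obtain ⟨s, hs, hsum⟩ := E.exists_sum_proj a
  have hne : s.Nonempty := by
    rw [Finset.nonempty_iff_ne_empty]
    rintro rfl
    exact ha (by simpa using hsum)
  obtain ⟨m, hm, hmax⟩ := s.exists_max_image φ hne
  exact ⟨m, (hs m).mp hm, fun t ht => hmax t ((hs t).mpr ht)⟩

theorem mem_A_of_forall (h : ∀ s, E.proj s a ≠ 0 → s = m) : a ∈ E.A m := by
  obtain ⟨s, hs, hsum⟩ := E.exists_sum_proj a
  rw [hsum]
  exact sum_mem fun t ht => h t ((hs t).mp ht) ▸ proj_mem a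

section Domain

variable [NoZeroDivisors R]

theorem degree_le_of_intertwine {Γ : Type*} [AddCommGroup Γ] [LinearOrder Γ]
    [IsOrderedAddMonoid Γ] (φ : (Fin r → ℤ) →+ Γ) (hφ : Function.Injective φ)
    {u c c' : R} {ρ : Fin r → ℤ} (hu : u ≠ 0) (hc : c ∈ E.A ρ)
    (h : u * c = c' * u ∨ c * u = u * c') {s : Fin r → ℤ} (hs : E.proj s c' ≠ 0) :
    φ s ≤ φ ρ := by
  have hc' : c' ≠ 0 := by
    rintro rfl
    simp at hs
  obtain ⟨m, hm, hmax⟩ := exists_max_degree (E := E) φ hu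
  obtain ⟨m', hm', hmax'⟩ := exists_max_degree (E := E) φ hc'
  have key : ∃ t, E.proj t u ≠ 0 ∧ m + m' = t + ρ := by
    refine ⟨m + m' - ρ, ?_, by abel⟩
    rcases h with h | h
    · have h1 := proj_mul_of_max φ hφ hmax' hmax
      rw [← h, show m' + m = m + m' - ρ + ρ by abel, proj_mul_right hc] at h1
      intro h0
      rw [h0, zero_mul] at h1
      exact mul_ne_zero hm' hm h1.symm
    · have h1 := proj_mul_of_max φ hφ hmax hmax'
      rw [← h, show m + m' = ρ + (m + m' - ρ) by abel, proj_mul_left hc] at h1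
      intro h0
      rw [h0, mul_zero] at h1
      exact mul_ne_zero hm hm' h1.symm
  obtain ⟨t, ht, hsum⟩ := key
  have h1 := hmax t ht
  have h2 : φ m + φ m' = φ t + φ ρ := by rw [← map_add, hsum, map_add]
  refine (hmax' s hs).trans ?_
  by_contra hlt
  exact (add_lt_add_of_le_of_lt h1 (not_le.mp hlt)).ne h2.symm

/-- Conjugation by any nonzero element preserves homogeneity and degrees. -/
theorem mem_A_of_intertwine {u c c' : R} {ρ : Fin r → ℤ} (hu : u ≠ 0) (hc : c ∈ E.A ρ)
    (h : u * c = c' * u ∨ c * u = u * c') : c' ∈ E.A ρ := by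
  refine mem_A_of_forall fun s hs => ?_
  let φ : (Fin r → ℤ) →+ Lex (Fin r → ℤ) := ⟨⟨toLex, rfl⟩, fun _ _ => rfl⟩
  have hφ : Function.Injective φ := toLex.injective
  have h1 := degree_le_of_intertwine φ hφ hu hc h hs
  have h2 := degree_le_of_intertwine (-φ) (fun a b hab => hφ (neg_injective hab)) hu hc h hs
  exact hφ (le_antisymm h1 (neg_le_neg_iff.mp h2))

end Domain

end CGLData

/-! ### The tower of subalgebras of a CGL extension -/

/-- Exponents supported on the indices below `k`. -/
def expBelow (N k : ℕ) : Set (Fin N → ℕ) := {f | ∀ j : Fin N, k ≤ j → f j = 0}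

theorem update_mem_expBelow {N : ℕ} {k : Fin N} {f : Fin N → ℕ} (hf : f ∈ expBelow N k) (i : ℕ) :
    Function.update f k i ∈ expBelow N (k + 1) := fun j hj => by
  have hkj : k < j := Fin.lt_def.mpr hj
  rw [Function.update_of_ne hkj.ne']
  exact hf j hkj.le

theorem update_zero_mem_expBelow {N : ℕ} {k : Fin N} {f : Fin N → ℕ}
    (hf : f ∈ expBelow N (k + 1)) : Function.update f k 0 ∈ expBelow N k := fun j hj => by
  rcases eq_or_lt_of_le (Fin.le_def.mpr hj) with rfl | h
  · exact Function.update_self ..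
  · rw [Function.update_of_ne h.ne']
    exact hf j h

theorem colexLT_of_apply_lt {N : ℕ} {k : Fin N} {f g : Fin N → ℕ} (hf : f ∈ expBelow N (k + 1))
    (hg : g ∈ expBelow N (k + 1)) (h : f k < g k) : ColexLT f g :=
  ⟨k, h, fun j hj => by rw [hf j hj, hg j hj]⟩

theorem colexLT_of_mem_of_notMem {N k : ℕ} {f g : Fin N → ℕ} (hf : f ∈ expBelow N k)
    (hg : g ∉ expBelow N k) : ColexLT f g := by
  rcases ColexLT.lt_or_gt (f := f) (g := g) (fun h => hg (h ▸ hf)) with h | h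
  · exact h
  · exact absurd (h.eq_zero_of_le hf) hg

namespace CGLData

variable {K : Type*} [Field K] {R : Type*} [Ring R] [Algebra K R] {N r : ℕ}
  {E : CGLData K R N r} {a b : R} {f g : Fin N → ℕ} {m : Fin r → ℤ}

theorem x_mem_sub {k : ℕ} {j : Fin N} (h : (j : ℕ) < k) : E.x j ∈ E.sub k :=
  Algebra.subset_adjoin ⟨j, h, rfl⟩

theorem sub_mono {k l : ℕ} (h : k ≤ l) : E.sub k ≤ E.sub l :=
  Algebra.adjoin_mono fun _ ⟨j, hj, hz⟩ => ⟨j, hj.trans_le h, hz⟩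

theorem xmon_mem_sub {k : ℕ} (hf : f ∈ expBelow N k) : xmon E.x f ∈ E.sub k :=
  xmon_mem _ _ _ fun i hi => x_mem_sub (by
    by_contra h
    exact hi (hf i (not_lt.mp h)))

theorem IsCGL.linearIndependent (hE : E.IsCGL) : LinearIndependent K (xmon E.x) := by
  rw [linearIndependent_iff]
  intro c hc
  obtain ⟨c₀, _, huniq⟩ := hE.pbw 0
  rw [huniq c (by rw [← hc]; rfl), huniq 0 (by simp)]

theorem IsCGL.span_xmon (hE : E.IsCGL) : Submodule.span K (Set.range (xmon E.x)) = ⊤ := by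
  rw [eq_top_iff]
  intro a _
  obtain ⟨c, rfl, _⟩ := hE.pbw a
  exact sum_mem fun f _ => Submodule.smul_mem _ _ (Submodule.subset_span ⟨f, rfl⟩)

theorem IsCGL.nontrivial (hE : E.IsCGL) : Nontrivial R :=
  ⟨_, 0, hE.linearIndependent.ne_zero (0 : Fin N → ℕ)⟩

theorem IsCGL.xmon_mem_A (hE : E.IsCGL) (f : Fin N → ℕ) : ∃ m, xmon E.x f ∈ E.A m :=
  xmon_homogeneous (fun i => ⟨_, hE.xhom i⟩) f

theorem x_mul (k : Fin N) (a : R) : E.x k * a = E.act (E.h k) a * E.x k + E.D k a := by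
  simp [D]

/-- The span of the elements `a * x_k^i` with `a ∈ R_{k-1}` and `i < n`. -/
def skewSpan (E : CGLData K R N r) (k : Fin N) (n : ℕ) : Submodule K R :=
  Submodule.span K {z | ∃ a ∈ E.sub (k : ℕ), ∃ i < n, z = a * E.x k ^ i}

theorem mul_mem_skewSpan {k : Fin N} {n : ℕ} (ha : a ∈ E.sub (k : ℕ)) (hb : b ∈ E.skewSpan k n) :
    a * b ∈ E.skewSpan k n := by
  induction hb using Submodule.span_induction with
  | mem z hz =>
    obtain ⟨c, hc, i, hi, rfl⟩ := hz
    exact Submodule.subset_span ⟨a * c, mul_mem ha hc, i, hi, by rw [mul_assoc]⟩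
  | zero => simp
  | add y z _ _ hy hz => rw [mul_add]; exact add_mem hy hz
  | smul t z _ hz => rw [mul_smul_comm]; exact Submodule.smul_mem _ _ hz

theorem mul_pow_mem_skewSpan {k : Fin N} {n : ℕ} (hb : b ∈ E.skewSpan k n) (l : ℕ) :
    b * E.x k ^ l ∈ E.skewSpan k (n + l) := by
  induction hb using Submodule.span_induction with
  | mem z hz =>
    obtain ⟨c, hc, i, hi, rfl⟩ := hz
    exact Submodule.subset_span ⟨c, hc, i + l, by omega, by rw [mul_assoc, pow_add]⟩
  | zero => simp
  | add y z _ _ hy hz => rw [add_mul]; exact add_mem hy hz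
  | smul t z _ hz => rw [smul_mul_assoc]; exact Submodule.smul_mem _ _ hz

theorem IsCGL.x_mul_mem_skewSpan (hE : E.IsCGL) {k : Fin N} {n : ℕ} (hb : b ∈ E.skewSpan k n) :
    E.x k * b ∈ E.skewSpan k (n + 1) := by
  induction hb using Submodule.span_induction with
  | mem z hz =>
    obtain ⟨c, hc, i, hi, rfl⟩ := hz
    rw [← mul_assoc, x_mul, add_mul, mul_assoc, ← pow_succ']
    exact add_mem
      (Submodule.subset_span ⟨_, hE.sigma_stab k c hc, i + 1, by omega, rfl⟩)
      (Submodule.subset_span ⟨_, hE.delta_stab k c hc, i, by omega, rfl⟩)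
  | zero => simp
  | add y z _ _ hy hz => rw [mul_add]; exact add_mem hy hz
  | smul t z _ hz => rw [mul_smul_comm]; exact Submodule.smul_mem _ _ hz

theorem skewSpan_mono (k : Fin N) {n n' : ℕ} (h : n ≤ n') : E.skewSpan k n ≤ E.skewSpan k n' :=
  Submodule.span_mono fun _ ⟨a, ha, i, hi, hz⟩ => ⟨a, ha, i, hi.trans_le h, hz⟩

theorem IsCGL.exists_mem_skewSpan (hE : E.IsCGL) {k : Fin N} (ha : a ∈ E.sub ((k : ℕ) + 1)) :
    ∃ n, a ∈ E.skewSpan k n := by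
  have key : ∀ n, ∀ t ∈ E.skewSpan k n, ∃ n', a * t ∈ E.skewSpan k n' := by
    induction ha using Algebra.adjoin_induction with
    | mem z hz =>
      obtain ⟨j, hj, rfl⟩ := hz
      intro n t ht
      rcases Nat.lt_succ_iff_lt_or_eq.mp hj with h | h
      · exact ⟨n, mul_mem_skewSpan (x_mem_sub h) ht⟩
      · rw [Fin.ext h]
        exact ⟨n + 1, hE.x_mul_mem_skewSpan ht⟩
    | algebraMap c =>
      intro n t ht
      exact ⟨n, mul_mem_skewSpan (Subalgebra.algebraMap_mem _ c) ht⟩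
    | add y z _ _ hy hz =>
      intro n t ht
      obtain ⟨n₁, h₁⟩ := hy n t ht
      obtain ⟨n₂, h₂⟩ := hz n t ht
      rw [add_mul]
      exact ⟨max n₁ n₂, add_mem (skewSpan_mono k (le_max_left _ _) h₁)
        (skewSpan_mono k (le_max_right _ _) h₂)⟩
    | mul y z _ _ hy hz =>
      intro n t ht
      obtain ⟨n₁, h₁⟩ := hz n t ht
      rw [mul_assoc]
      exact hy n₁ _ h₁
  obtain ⟨n, hn⟩ := key 1 1 (Submodule.subset_span ⟨1, one_mem _, 0, by simp, by simp⟩)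
  exact ⟨n, by simpa using hn⟩

theorem IsCGL.mem_span_xmon (hE : E.IsCGL) {k : ℕ} (hk : k ≤ N) (ha : a ∈ E.sub k) :
    a ∈ Submodule.span K (xmon E.x '' expBelow N k) := by
  induction k generalizing a with
  | zero =>
    have h0 : {y : R | ∃ j : Fin N, (j : ℕ) < 0 ∧ y = E.x j} = ∅ := by simp
    rw [sub, h0, Algebra.adjoin_empty, Algebra.mem_bot] at ha
    obtain ⟨c, rfl⟩ := ha
    rw [Algebra.algebraMap_eq_smul_one, ← xmon_zero E.x]
    exact Submodule.smul_mem _ _ (Submodule.subset_span ⟨0, fun _ _ => rfl, rfl⟩)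
  | succ k ih =>
    let k' : Fin N := ⟨k, hk⟩
    obtain ⟨n, hn⟩ := hE.exists_mem_skewSpan (k := k') ha
    clear ha
    induction hn using Submodule.span_induction with
    | mem z hz =>
      obtain ⟨c, hc, i, _, rfl⟩ := hz
      have hc' := ih (by omega) hc
      clear hc
      induction hc' using Submodule.span_induction with
      | mem z hz =>
        obtain ⟨f, hf, rfl⟩ := hz
        rw [xmon_mul_pow E.x k' f hf]
        exact Submodule.subset_span ⟨_, update_mem_expBelow (k := k') hf i, rfl⟩
      | zero => simp
      | add y z _ _ hy hz => rw [add_mul]; exact add_mem hy hz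
      | smul t z _ hz => rw [smul_mul_assoc]; exact Submodule.smul_mem _ _ hz
    | zero => simp
    | add y z _ _ hy hz => exact add_mem hy hz
    | smul t z _ hz => exact Submodule.smul_mem _ _ hz

theorem IsCGL.sub_eq_top (hE : E.IsCGL) : E.sub N = ⊤ := by
  rw [← Algebra.toSubmodule_eq_top, eq_top_iff, ← hE.span_xmon, Submodule.span_le]
  rintro _ ⟨f, rfl⟩
  exact xmon_mem_sub fun j hj => absurd j.2 (not_lt.mpr hj)

theorem IsCGL.exists_hasLead (hE : E.IsCGL) (h0 : a ≠ 0) : ∃ f, HasLead K E.x a f := by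
  have ha : a ∈ Submodule.span K (xmon E.x '' Set.univ) := by
    rw [Set.image_univ, hE.span_xmon]
    trivial
  obtain ⟨f, _, hf⟩ := exists_hasLead_of_mem_span ha h0
  exact ⟨f, hf⟩

theorem IsCGL.mem_expBelow (hE : E.IsCGL) {k : ℕ} (hk : k ≤ N) (ha : a ∈ E.sub k)
    (hf : HasLead K E.x a f) : f ∈ expBelow N k := by
  obtain ⟨g, hg, hg'⟩ := exists_hasLead_of_mem_span (hE.mem_span_xmon hk ha)
    (hf.ne_zero hE.linearIndependent)
  rwa [hf.unique hE.linearIndependent hg']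

theorem mem_sub_of_mem_lowerSpan {k : ℕ} (hf : f ∈ expBelow N k)
    (ha : a ∈ lowerSpan K E.x f) : a ∈ E.sub k := by
  have : lowerSpan K E.x f ≤ Subalgebra.toSubmodule (E.sub k) := by
    refine Submodule.span_le.mpr ?_
    rintro _ ⟨g, hg, rfl⟩
    exact xmon_mem_sub (ColexLT.eq_zero_of_le hg hf)
  exact this ha

theorem mem_sub_of_hasLead {k : ℕ} (hf : f ∈ expBelow N k) (ha : HasLead K E.x a f) :
    a ∈ E.sub k := by
  obtain ⟨c, _, l, hl, rfl⟩ := ha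
  exact add_mem (Subalgebra.smul_mem _ (xmon_mem_sub hf) c) (mem_sub_of_mem_lowerSpan hf hl)

theorem mul_pow_mem_lowerSpan {k : Fin N} {i : ℕ} (hf : f ∈ expBelow N k)
    (ha : a ∈ lowerSpan K E.x f) :
    a * E.x k ^ i ∈ lowerSpan K E.x (Function.update f k i) := by
  induction ha using Submodule.span_induction with
  | mem z hz =>
    obtain ⟨g, hg, rfl⟩ := hz
    have hg' : g ∈ expBelow N k := ColexLT.eq_zero_of_le hg hf
    rw [xmon_mul_pow _ _ _ hg']
    refine xmon_mem_lowerSpan ?_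
    obtain ⟨l, hl, hl'⟩ := hg
    have hlk : l < k := by
      by_contra h
      rw [hf l (Fin.le_def.mp (not_lt.mp h))] at hl
      omega
    refine ⟨l, by rwa [Function.update_of_ne hlk.ne, Function.update_of_ne hlk.ne], ?_⟩
    intro j hj
    by_cases hjk : j = k
    · subst hjk; simp
    · rw [Function.update_of_ne hjk, Function.update_of_ne hjk, hl' j hj]
  | zero => simp
  | add y z _ _ hy hz => rw [add_mul]; exact add_mem hy hz
  | smul t z _ hz => rw [smul_mul_assoc]; exact Submodule.smul_mem _ _ hz

theorem hasLead_mul_pow {k : Fin N} (i : ℕ) (hf : f ∈ expBelow N k)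
    (ha : HasLead K E.x a f) : HasLead K E.x (a * E.x k ^ i) (Function.update f k i) := by
  obtain ⟨c, hc, l, hl, rfl⟩ := ha
  exact ⟨c, hc, _, mul_pow_mem_lowerSpan hf hl, by
    rw [add_mul, smul_mul_assoc, xmon_mul_pow _ _ _ hf]⟩

theorem IsCGL.skewSpan_le_lowerSpan (hE : E.IsCGL) {k : Fin N} (hf : f ∈ expBelow N (k + 1)) :
    E.skewSpan k (f k) ≤ lowerSpan K E.x f := by
  refine Submodule.span_le.mpr ?_
  rintro _ ⟨a, ha, i, hi, rfl⟩
  have ha' := hE.mem_span_xmon k.2.le ha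
  clear ha
  induction ha' using Submodule.span_induction with
  | mem z hz =>
    obtain ⟨g, hg, rfl⟩ := hz
    rw [xmon_mul_pow _ _ _ hg]
    exact xmon_mem_lowerSpan
      (colexLT_of_apply_lt (update_mem_expBelow hg i) hf (by simpa using hi))
  | zero => simp
  | add y z _ _ hy hz => rw [add_mul]; exact add_mem hy hz
  | smul t z _ hz => rw [smul_mul_assoc]; exact Submodule.smul_mem _ _ hz

theorem IsCGL.x_pow_mul (hE : E.IsCGL) {k : Fin N} (hb : b ∈ E.sub (k : ℕ)) (hb' : b ∈ E.A m)
    (i : ℕ) : ∃ c : K, c ≠ 0 ∧ ∃ s ∈ E.skewSpan k i,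
      E.x k ^ i * b = c • (b * E.x k ^ i) + s := by
  induction i with
  | zero => exact ⟨1, one_ne_zero, 0, zero_mem _, by simp⟩
  | succ i ih =>
    obtain ⟨c, hc, s, hs, h⟩ := ih
    refine ⟨c * (tpow (E.h k) m : Kˣ), mul_ne_zero hc (Units.ne_zero _),
      c • (E.D k b * E.x k ^ i) + E.x k * s, ?_, ?_⟩
    · exact add_mem (Submodule.smul_mem _ _ (Submodule.subset_span
        ⟨_, hE.delta_stab k b hb, i, by omega, rfl⟩)) (hE.x_mul_mem_skewSpan hs)
    · rw [pow_succ', mul_assoc, h, mul_add, mul_smul_comm, ← mul_assoc, x_mul, act_of_mem _ hb',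
        add_mul, smul_mul_assoc, smul_mul_assoc, mul_assoc, smul_add, smul_smul, add_assoc,
        ← pow_succ']

theorem IsCGL.hasLead_xmon_mul (hE : E.IsCGL) {k : ℕ} (hk : k ≤ N) (hf : f ∈ expBelow N k)
    (hg : g ∈ expBelow N k) : HasLead K E.x (xmon E.x f * xmon E.x g) (f + g) := by
  induction k generalizing f g with
  | zero =>
    have h0 : ∀ f ∈ expBelow N 0, f = 0 := fun f hf => funext fun j => hf j (Nat.zero_le _)
    rw [h0 f hf, h0 g hg, xmon_zero, mul_one, ← xmon_zero E.x, add_zero]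
    exact hasLead_xmon _ _
  | succ k ih =>
    let k' : Fin N := ⟨k, hk⟩
    have hf0 := update_zero_mem_expBelow (k := k') hf
    have hg0 := update_zero_mem_expBelow (k := k') hg
    obtain ⟨mg, hmg⟩ := hE.xmon_mem_A (Function.update g k' 0)
    obtain ⟨c, hc, s, hs, h⟩ := hE.x_pow_mul (xmon_mem_sub hg0) hmg (f k')
    have hfg : f + g ∈ expBelow N (k' + 1) := fun j hj => by simp [hf j hj, hg j hj]
    have hupd : Function.update (Function.update f k' 0 + Function.update g k' 0) k'
        (f k' + g k') = f + g := by
      funext j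
      by_cases hj : j = k'
      · subst hj; simp
      · simp [Function.update_of_ne hj]
    have heq : xmon E.x f * xmon E.x g =
        c • (xmon E.x (Function.update f k' 0) * xmon E.x (Function.update g k' 0)
          * E.x k' ^ (f k' + g k'))
        + xmon E.x (Function.update f k' 0) * (s * E.x k' ^ g k') := by
      rw [xmon_split E.x k' f hf, xmon_split E.x k' g hg]
      calc _ = xmon E.x (Function.update f k' 0) * (E.x k' ^ f k' *
          xmon E.x (Function.update g k' 0)) * E.x k' ^ g k' := by simp only [mul_assoc]
        _ = _ := by
          rw [h, mul_add, add_mul, mul_smul_comm, smul_mul_assoc, pow_add]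
          simp only [mul_assoc]
    rw [heq]
    refine HasLead.add_mem_lowerSpan (HasLead.smul ?_ hc) ?_
    · rw [← hupd]
      refine hasLead_mul_pow _ ?_ (ih (by omega) hf0 hg0)
      exact fun j hj => by rw [Pi.add_apply, hf0 j hj, hg0 j hj]
    · exact hE.skewSpan_le_lowerSpan hfg (mul_mem_skewSpan (xmon_mem_sub hf0)
        (mul_pow_mem_skewSpan hs _))

theorem IsCGL.hasLead_mul (hE : E.IsCGL) (ha : HasLead K E.x a f) (hb : HasLead K E.x b g) :
    HasLead K E.x (a * b) (f + g) := by
  have hN : ∀ f : Fin N → ℕ, f ∈ expBelow N N := fun f j hj => absurd j.2 (not_lt.mpr hj)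
  have hmon : ∀ f g, HasLead K E.x (xmon E.x f * xmon E.x g) (f + g) := fun f g =>
    hE.hasLead_xmon_mul le_rfl (hN f) (hN g)
  have hlow : ∀ f', (f' = f ∨ ColexLT f' f) → ∀ l ∈ lowerSpan K E.x g,
      xmon E.x f' * l ∈ lowerSpan K E.x (f + g) := by
    intro f' hf' l hl
    induction hl using Submodule.span_induction with
    | mem z hz =>
      obtain ⟨g', hg', rfl⟩ := hz
      refine (hmon f' g').mem_lowerSpan ?_
      rcases hf' with rfl | hf'
      · exact ColexLT.add_left hg' _
      · exact (hf'.add_right _).trans (ColexLT.add_left hg' _)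
    | zero => simp
    | add y z _ _ hy hz => rw [mul_add]; exact add_mem hy hz
    | smul t z _ hz => rw [mul_smul_comm]; exact Submodule.smul_mem _ _ hz
  have hlow' : ∀ l ∈ lowerSpan K E.x f, l * xmon E.x g ∈ lowerSpan K E.x (f + g) := by
    intro l hl
    induction hl using Submodule.span_induction with
    | mem z hz =>
      obtain ⟨f', hf', rfl⟩ := hz
      exact (hmon f' g).mem_lowerSpan (hf'.add_right _)
    | zero => simp
    | add y z _ _ hy hz => rw [add_mul]; exact add_mem hy hz
    | smul t z _ hz => rw [smul_mul_assoc]; exact Submodule.smul_mem _ _ hz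
  have hlow'' : ∀ l ∈ lowerSpan K E.x f, ∀ l' ∈ lowerSpan K E.x g,
      l * l' ∈ lowerSpan K E.x (f + g) := by
    intro l hl l' hl'
    induction hl using Submodule.span_induction with
    | mem z hz =>
      obtain ⟨f', hf', rfl⟩ := hz
      exact hlow f' (Or.inr hf') l' hl'
    | zero => simp
    | add y z _ _ hy hz => rw [add_mul]; exact add_mem hy hz
    | smul t z _ hz => rw [smul_mul_assoc]; exact Submodule.smul_mem _ _ hz
  obtain ⟨c, hc, l, hl, rfl⟩ := ha
  obtain ⟨c', hc', l', hl', rfl⟩ := hb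
  have heq : (c • xmon E.x f + l) * (c' • xmon E.x g + l') =
      (c * c') • (xmon E.x f * xmon E.x g) +
        (c • (xmon E.x f * l') + c' • (l * xmon E.x g) + l * l') := by
    rw [add_mul, mul_add, mul_add, smul_mul_smul_comm, smul_mul_assoc, mul_smul_comm]
    abel
  rw [heq]
  exact ((hmon f g).smul (mul_ne_zero hc hc')).add_mem_lowerSpan
    (add_mem (add_mem (Submodule.smul_mem _ _ (hlow f (Or.inl rfl) l' hl'))
      (Submodule.smul_mem _ _ (hlow' l hl))) (hlow'' l hl l' hl'))

theorem IsCGL.noZeroDivisors (hE : E.IsCGL) : NoZeroDivisors R where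
  eq_zero_or_eq_zero_of_mul_eq_zero {a b} h := by
    by_contra! hne
    obtain ⟨f, hf⟩ := hE.exists_hasLead hne.1
    obtain ⟨g, hg⟩ := hE.exists_hasLead hne.2
    exact (hE.hasLead_mul hf hg).ne_zero hE.linearIndependent h

theorem IsCGL.hasLead_pow (hE : E.IsCGL) (ha : HasLead K E.x a f) (i : ℕ) :
    HasLead K E.x (a ^ i) (i • f) := by
  induction i with
  | zero =>
    rw [pow_zero, zero_smul, ← xmon_zero E.x]
    exact hasLead_xmon _ _
  | succ i ih =>
    rw [pow_succ, succ_nsmul]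
    exact hE.hasLead_mul ih ha

theorem proj_mem_sub (hE : E.IsCGL) {k : ℕ} (hk : k ≤ N) (ha : a ∈ E.sub k) :
    E.proj m a ∈ E.sub k := by
  have ha' := hE.mem_span_xmon hk ha
  clear ha
  induction ha' using Submodule.span_induction with
  | mem z hz =>
    obtain ⟨f, hf, rfl⟩ := hz
    obtain ⟨m', hm'⟩ := hE.xmon_mem_A f
    by_cases h : m' = m
    · subst h
      rw [proj_of_mem hm']
      exact xmon_mem_sub hf
    · rw [proj_of_mem_ne hm' h]
      exact zero_mem _
  | zero => simp
  | add y z _ _ hy hz => rw [map_add]; exact add_mem hy hz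
  | smul t z _ hz => rw [map_smul]; exact Subalgebra.smul_mem _ hz t

end CGLData

/-! ### Normalizing elements -/

/-- `u` normalizes the subalgebra `S`: `uS = Su`. The element `u` need not lie in `S`. -/
def Normalizes {K : Type*} [Field K] {R : Type*} [Ring R] [Algebra K R] (S : Subalgebra K R)
    (u : R) : Prop :=
  (∀ a ∈ S, ∃ b ∈ S, u * a = b * u) ∧ ∀ a ∈ S, ∃ b ∈ S, a * u = u * b

section Normalizes

variable {K : Type*} [Field K] {R : Type*} [Ring R] [Algebra K R] {S : Subalgebra K R} {u v : R}

theorem normalIn_iff : NormalIn (S : Set R) u ↔ Normalizes S u := by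
  constructor
  · intro h
    refine ⟨fun a ha => ?_, fun a ha => ?_⟩
    · have : u * a ∈ {y : R | ∃ b ∈ (S : Set R), y = b * u} := h ▸ ⟨a, ha, rfl⟩
      exact this
    · have : a * u ∈ {y : R | ∃ b ∈ (S : Set R), y = u * b} := h ▸ ⟨a, ha, rfl⟩
      exact this
  · rintro ⟨h₁, h₂⟩
    ext y
    constructor
    · rintro ⟨b, hb, rfl⟩
      exact h₁ b hb
    · rintro ⟨b, hb, rfl⟩
      exact h₂ b hb

theorem isNormalElem_iff (K : Type*) [Field K] {R : Type*} [Ring R] [Algebra K R] {u : R} :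
    IsNormalElem u ↔ Normalizes (⊤ : Subalgebra K R) u := by
  rw [← normalIn_iff]
  simp [IsNormalElem, NormalIn]

theorem normalizes_one : Normalizes S 1 :=
  ⟨fun a ha => ⟨a, ha, by simp⟩, fun a ha => ⟨a, ha, by simp⟩⟩

theorem Normalizes.mul (hu : Normalizes S u) (hv : Normalizes S v) : Normalizes S (u * v) := by
  constructor
  · intro a ha
    obtain ⟨b, hb, h⟩ := hv.1 a ha
    obtain ⟨c, hc, h'⟩ := hu.1 b hb
    exact ⟨c, hc, by rw [mul_assoc, h, ← mul_assoc, h', mul_assoc]⟩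
  · intro a ha
    obtain ⟨b, hb, h⟩ := hu.2 a ha
    obtain ⟨c, hc, h'⟩ := hv.2 b hb
    exact ⟨c, hc, by rw [← mul_assoc, h, mul_assoc, h', mul_assoc]⟩

theorem Normalizes.pow (hu : Normalizes S u) (i : ℕ) : Normalizes S (u ^ i) := by
  induction i with
  | zero => rw [pow_zero]; exact normalizes_one
  | succ i ih => rw [pow_succ]; exact ih.mul hu

variable [NoZeroDivisors R]

theorem Normalizes.of_mul_left (hu : Normalizes S u) (hu0 : u ≠ 0) (h : Normalizes S (u * v)) :
    Normalizes S v := by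
  constructor
  · intro a ha
    obtain ⟨b, hb, h₁⟩ := h.1 a ha
    obtain ⟨c, hc, h₂⟩ := hu.2 b hb
    refine ⟨c, hc, mul_left_cancel₀ hu0 ?_⟩
    rw [← mul_assoc, h₁, ← mul_assoc, h₂, mul_assoc]
  · intro a ha
    obtain ⟨b, hb, h₁⟩ := hu.1 a ha
    obtain ⟨c, hc, h₂⟩ := h.2 b hb
    refine ⟨c, hc, mul_left_cancel₀ hu0 ?_⟩
    rw [← mul_assoc, h₁, mul_assoc, h₂, mul_assoc]

theorem Normalizes.of_mul_right (hu : Normalizes S u) (hu0 : u ≠ 0) (h : Normalizes S (v * u)) :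
    Normalizes S v := by
  constructor
  · intro a ha
    obtain ⟨b, hb, h₁⟩ := hu.2 a ha
    obtain ⟨c, hc, h₂⟩ := h.1 b hb
    refine ⟨c, hc, mul_right_cancel₀ hu0 ?_⟩
    rw [mul_assoc, h₁, ← mul_assoc, h₂, mul_assoc]
  · intro a ha
    obtain ⟨b, hb, h₁⟩ := h.2 a ha
    obtain ⟨c, hc, h₂⟩ := hu.1 b hb
    refine ⟨c, hc, mul_right_cancel₀ hu0 ?_⟩
    rw [mul_assoc, h₁, mul_assoc, h₂, mul_assoc]

theorem IsPrimeElemIn.conj {y t : R} (hy : IsPrimeElemIn (S : Set R) y) (hu : Normalizes S u)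
    (hu0 : u ≠ 0) (ht : t ∈ S) (h : u * y = t * u) : IsPrimeElemIn (S : Set R) t := by
  obtain ⟨-, hy0, hyn, hy1, hyp⟩ := hy
  rw [normalIn_iff] at hyn
  refine ⟨ht, ?_, normalIn_iff.mpr ⟨fun a ha => ?_, fun a ha => ?_⟩, ?_, ?_⟩
  · rintro rfl
    rw [zero_mul] at h
    exact mul_ne_zero hu0 hy0 h
  · obtain ⟨a', ha', h₁⟩ := hu.2 a ha
    obtain ⟨b, hb, h₂⟩ := hyn.1 a' ha'
    obtain ⟨b', hb', h₃⟩ := hu.1 b hb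
    refine ⟨b', hb', mul_right_cancel₀ hu0 ?_⟩
    rw [mul_assoc, h₁, ← mul_assoc, ← h, mul_assoc, h₂, ← mul_assoc, h₃, mul_assoc, h, mul_assoc]
  · obtain ⟨a', ha', h₁⟩ := hu.2 a ha
    obtain ⟨b, hb, h₂⟩ := hyn.2 a' ha'
    obtain ⟨b', hb', h₃⟩ := hu.1 b hb
    refine ⟨b', hb', mul_right_cancel₀ hu0 ?_⟩
    rw [mul_assoc, ← h, ← mul_assoc, h₁, mul_assoc, h₂, ← mul_assoc, h, mul_assoc, h₃, mul_assoc]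
  · rintro ⟨b, hb, h₁⟩
    obtain ⟨b', hb', h₂⟩ := hu.2 b hb
    refine hy1 ⟨b', hb', mul_left_cancel₀ hu0 ?_⟩
    rw [← mul_assoc, ← h₂, mul_assoc, h, ← mul_assoc, ← h₁, one_mul, mul_one]
  · rintro a ha b hb ⟨c, hc, h₁⟩
    have key : ∀ a a', a * u = u * a' → DvdIn (S : Set R) y a' → DvdIn (S : Set R) t a := by
      rintro a a' h₂ ⟨e, he, rfl⟩
      obtain ⟨e', he', h₃⟩ := hu.1 e he
      refine ⟨e', he', mul_right_cancel₀ hu0 ?_⟩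
      rw [h₂, ← mul_assoc, h₃, mul_assoc, h, mul_assoc]
    obtain ⟨a', ha', h₂⟩ := hu.2 a ha
    obtain ⟨b', hb', h₃⟩ := hu.2 b hb
    obtain ⟨c', hc', h₄⟩ := hu.2 c hc
    have h₅ : a' * b' = c' * y := by
      refine mul_left_cancel₀ hu0 ?_
      rw [← mul_assoc, ← h₂, mul_assoc, ← h₃, ← mul_assoc, h₁, mul_assoc, ← h, ← mul_assoc, h₄,
        mul_assoc]
    exact (hyp a' ha' b' hb' ⟨c', hc', h₅⟩).imp (key a a' h₂) (key b b' h₃)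

end Normalizes

/-! ### The homogeneous prime elements of the tower -/

/-- The exponent `∑ eᵢ` over the `i ≤ k` in the level set of `k`. -/
def levelExp {N n : ℕ} (μ : Fin N → Fin n) (k : Fin N) : Fin N → ℕ :=
  fun i => if i ≤ k ∧ μ i = μ k then 1 else 0

/-- `j` is the largest index below `k` in its level set. -/
def IsLastBelow {N n : ℕ} (μ : Fin N → Fin n) (k : ℕ) (j : Fin N) : Prop :=
  (j : ℕ) < k ∧ ∀ j' : Fin N, j < j' → (j' : ℕ) < k → μ j' ≠ μ j

section Levels

variable {N n : ℕ} {μ : Fin N → Fin n} {j k : Fin N}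

theorem levelExp_self (k : Fin N) : levelExp μ k k = 1 := by simp [levelExp]

theorem levelExp_mem_expBelow {l : ℕ} (h : (k : ℕ) < l) : levelExp μ k ∈ expBelow N l :=
  fun j hj => if_neg fun h' => absurd (Fin.le_def.mp h'.1) (by omega)

theorem levelExp_injective : Function.Injective (levelExp μ) := by
  have key : ∀ j k : Fin N, levelExp μ j = levelExp μ k → j ≤ k := by
    intro j k h
    by_contra hjk
    have := congrFun h j
    rw [levelExp_self, levelExp, if_neg (fun h' => hjk h'.1)] at this
    exact one_ne_zero this
  exact fun j k h => le_antisymm (key j k h) (key k j h.symm)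

theorem pInf_or_exists_isPred (μ : Fin N → Fin n) (k : Fin N) :
    PInf μ k ∨ ∃ j, IsPred μ j k := by
  by_cases h : PInf μ k
  · exact Or.inl h
  right
  simp only [PInf, not_forall, not_not] at h
  obtain ⟨j, hj, hjk⟩ := h
  let s := Finset.univ.filter fun j => j < k ∧ μ j = μ k
  have hs : s.Nonempty := ⟨j, by simp [s, hj, hjk]⟩
  have hmem := Finset.max'_mem s hs
  simp only [s, Finset.mem_filter, Finset.mem_univ, true_and] at hmem
  refine ⟨s.max' hs, hmem.1, hmem.2, fun j' hj' hjk' he => ?_⟩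
  exact absurd (Finset.le_max' s j' (by simp [s, hjk', he])) (not_le.mpr hj')

theorem levelExp_of_pInf (h : PInf μ k) : levelExp μ k = Function.update (0 : Fin N → ℕ) k 1 := by
  funext i
  by_cases hi : i = k
  · subst hi; simp [levelExp]
  · rw [Function.update_of_ne hi]
    exact if_neg fun h' => h i (lt_of_le_of_ne h'.1 hi) h'.2

theorem levelExp_of_isPred (h : IsPred μ j k) :
    levelExp μ k = Function.update (levelExp μ j) k 1 := by
  funext i
  by_cases hi : i = k
  · subst hi; simp [levelExp]
  · rw [Function.update_of_ne hi, levelExp, levelExp]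
    refine if_congr ⟨fun h' => ⟨?_, h'.2.trans h.2.1.symm⟩,
      fun h' => ⟨h'.1.trans h.1.le, h'.2.trans h.2.1⟩⟩ rfl rfl
    by_contra hij
    exact h.2.2 i (not_le.mp hij) (lt_of_le_of_ne h'.1 hi) h'.2

theorem isLastBelow_succ (k : Fin N) : IsLastBelow μ (k + 1) k :=
  ⟨Nat.lt_succ_self _, fun j' h h' => absurd (Fin.lt_def.mp h) (by omega)⟩

theorem IsPred.isLastBelow (h : IsPred μ j k) : IsLastBelow μ k j :=
  ⟨h.1, fun j' h' hk => h.2.1 ▸ h.2.2 j' h' hk⟩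

theorem isLastBelow_iff_sInf : IsLastBelow μ N j ↔ SInf μ j :=
  ⟨fun h j' hj' => h.2 j' hj' j'.2, fun h => ⟨j.2, fun j' hj' _ => h j' hj'⟩⟩

end Levels

namespace CGLData

variable {K : Type*} [Field K] {R : Type*} [Ring R] [Algebra K R] {N r : ℕ}
  {E : CGLData K R N r} {a b u : R} {f g : Fin N → ℕ} {m : Fin r → ℤ}

theorem IsCGL.hasLead_of_intertwine (hE : E.IsCGL) (hu : u ≠ 0) (ha : HasLead K E.x a f)
    (h : u * a = b * u ∨ a * u = u * b) : HasLead K E.x b f := by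
  have := hE.noZeroDivisors
  have hli := hE.linearIndependent
  have ha0 := ha.ne_zero hli
  have hb0 : b ≠ 0 := by
    rintro rfl
    rw [zero_mul, mul_zero] at h
    exact h.elim (mul_ne_zero hu ha0) (mul_ne_zero ha0 hu)
  obtain ⟨fu, hfu⟩ := hE.exists_hasLead hu
  obtain ⟨fb, hfb⟩ := hE.exists_hasLead hb0
  have : f = fb := by
    rcases h with h | h
    · have h₁ := hE.hasLead_mul hfu ha
      rw [h] at h₁
      have := h₁.unique hli (hE.hasLead_mul hfb hfu)
      rw [add_comm] at this
      exact add_right_cancel this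
    · have h₁ := hE.hasLead_mul ha hfu
      rw [h] at h₁
      have := h₁.unique hli (hE.hasLead_mul hfu hfb)
      rw [add_comm fu] at this
      exact add_right_cancel this
  rwa [this]

theorem IsCGL.mem_sub_of_intertwine (hE : E.IsCGL) {k : ℕ} (hk : k ≤ N) (hu : u ≠ 0)
    (ha : a ∈ E.sub k) (h : u * a = b * u ∨ a * u = u * b) : b ∈ E.sub k := by
  have := hE.noZeroDivisors
  by_cases ha0 : a = 0
  · subst ha0
    have hb : b = 0 := by
      rw [mul_zero, zero_mul] at h
      rcases h with h | h
      · exact (mul_eq_zero.mp h.symm).resolve_right hu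
      · exact (mul_eq_zero.mp h.symm).resolve_left hu
    rw [hb]
    exact zero_mem _
  · obtain ⟨f, hf⟩ := hE.exists_hasLead ha0
    exact mem_sub_of_hasLead (hE.mem_expBelow hk ha hf) (hE.hasLead_of_intertwine hu hf h)

theorem IsCGL.mem_sub_of_mul (hE : E.IsCGL) {k : ℕ} (hk : k ≤ N) (ha : a ≠ 0) (hb : b ≠ 0)
    (h : a * b ∈ E.sub k) : a ∈ E.sub k ∧ b ∈ E.sub k := by
  obtain ⟨f, hf⟩ := hE.exists_hasLead ha
  obtain ⟨g, hg⟩ := hE.exists_hasLead hb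
  have hfg := hE.mem_expBelow hk h (hE.hasLead_mul hf hg)
  have h₁ : ∀ j : Fin N, k ≤ j → f j = 0 ∧ g j = 0 := fun j hj =>
    Nat.add_eq_zero_iff.mp (hfg j hj)
  exact ⟨mem_sub_of_hasLead (fun j hj => (h₁ j hj).1) hf,
    mem_sub_of_hasLead (fun j hj => (h₁ j hj).2) hg⟩

theorem IsCGL.normalizes_mono (hE : E.IsCGL) {k l : ℕ} (hkl : k ≤ l) (hk : k ≤ N) (hu0 : u ≠ 0)
    (hu : Normalizes (E.sub l) u) : Normalizes (E.sub k) u := by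
  constructor
  · intro a ha
    obtain ⟨b, _, h⟩ := hu.1 a (sub_mono hkl ha)
    exact ⟨b, hE.mem_sub_of_intertwine hk hu0 ha (Or.inl h), h⟩
  · intro a ha
    obtain ⟨b, _, h⟩ := hu.2 a (sub_mono hkl ha)
    exact ⟨b, hE.mem_sub_of_intertwine hk hu0 ha (Or.inr h), h⟩

theorem IsCGL.mem_lowerSpan (hE : E.IsCGL) {k : ℕ} (hk : k ≤ N) (ha : a ∈ E.sub k)
    (hf : f ∉ expBelow N k) : a ∈ lowerSpan K E.x f := by
  refine Submodule.span_mono (Set.image_mono fun g hg => ?_) (hE.mem_span_xmon hk ha)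
  exact colexLT_of_mem_of_notMem hg hf

section Struct

variable {n : ℕ} {μ : Fin N → Fin n} {d y : Fin N → R}

theorem StructData.hasLead (hE : E.IsCGL) (hs : E.StructData μ d y) (k : Fin N) :
    HasLead K E.x (y k) (levelExp μ k) := by
  obtain ⟨-, hinf, hpred, -⟩ := hs
  induction k using WellFoundedLT.induction with
  | ind k ih =>
    rcases pInf_or_exists_isPred μ k with h | ⟨j, h⟩
    · rw [hinf k h, levelExp_of_pInf h, ← pow_one (E.x k), ← one_mul (E.x k ^ 1),
        ← xmon_zero E.x]
      exact hasLead_mul_pow 1 (fun _ _ => rfl) (hasLead_xmon E.x 0)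
    · obtain ⟨hd, hy⟩ := hpred k j h
      rw [hy, sub_eq_add_neg]
      refine HasLead.add_mem_lowerSpan ?_ (neg_mem (hE.mem_lowerSpan k.2.le hd fun h' => ?_))
      · rw [levelExp_of_isPred h]
        have := hasLead_mul_pow 1 (levelExp_mem_expBelow h.1) (ih j h.1)
        rwa [pow_one] at this
      · have := h' k le_rfl
        rw [levelExp_self] at this
        exact one_ne_zero this

theorem StructData.ne_zero (hE : E.IsCGL) (hs : E.StructData μ d y) (k : Fin N) : y k ≠ 0 :=
  (hs.hasLead hE k).ne_zero hE.linearIndependent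

theorem StructData.mem_sub (hE : E.IsCGL) (hs : E.StructData μ d y) {k : Fin N} {l : ℕ}
    (h : (k : ℕ) < l) : y k ∈ E.sub l :=
  mem_sub_of_hasLead (levelExp_mem_expBelow h) (hs.hasLead hE k)

theorem StructData.isHomogPrimeIn (hs : E.StructData μ d y) {k : ℕ} (hk : k ≤ N) {j : Fin N}
    (hj : IsLastBelow μ k j) : E.IsHomogPrimeIn (E.sub k : Set R) (y j) := by
  obtain ⟨-, -, -, -, hp, -⟩ := hs
  cases k with
  | zero => exact absurd hj.1 (Nat.not_lt_zero _)
  | succ k =>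
    refine (hp ⟨k, hk⟩).1 j (Fin.le_def.mpr (Nat.lt_succ_iff.mp hj.1)) fun j' h h' => ?_
    exact hj.2 j' h (Nat.lt_succ_iff.mpr (Fin.le_def.mp h'))

theorem StructData.normalizes (hs : E.StructData μ d y) {k : ℕ} (hk : k ≤ N) {j : Fin N}
    (hj : IsLastBelow μ k j) : Normalizes (E.sub k) (y j) :=
  normalIn_iff.mp (hs.isHomogPrimeIn hk hj).1.2.2.1

theorem StructData.exists_eq_smul (hE : E.IsCGL) (hs : E.StructData μ d y) {k : ℕ} (hk : k ≤ N)
    {j : Fin N} (hj : IsLastBelow μ k j) {p : R} (hp : E.IsHomogPrimeIn (E.sub k : Set R) p)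
    (hl : HasLead K E.x p (levelExp μ j)) : ∃ c : K, c ≠ 0 ∧ p = c • y j := by
  have hs' := hs
  obtain ⟨-, -, -, -, hc, -⟩ := hs'
  cases k with
  | zero => exact absurd hj.1 (Nat.not_lt_zero _)
  | succ k =>
    obtain ⟨j', -, -, t, rfl⟩ := (hc ⟨k, hk⟩).2.2 p hp
    have h := hl.unique hE.linearIndependent ((hs.hasLead hE j').smul t.ne_zero)
    rw [levelExp_injective h]
    exact ⟨t, t.ne_zero, rfl⟩

theorem StructData.exists_mul_eq_smul (hE : E.IsCGL) (hs : E.StructData μ d y) {k : ℕ}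
    (hk : k ≤ N) {j : Fin N} (hj : IsLastBelow μ k j) (hu0 : u ≠ 0)
    (hu : Normalizes (E.sub k) u) : ∃ c : K, c ≠ 0 ∧ u * y j = c • (y j * u) := by
  have := hE.noZeroDivisors
  have hp := hs.isHomogPrimeIn hk hj
  obtain ⟨t, ht, h⟩ := hu.1 (y j) hp.1.1
  obtain ⟨m, hm⟩ := hp.2
  obtain ⟨c, hc, rfl⟩ := hs.exists_eq_smul hE hk hj
    ⟨hp.1.conj hu hu0 ht h, m, mem_A_of_intertwine hu0 hm (Or.inl h)⟩
    (hE.hasLead_of_intertwine hu0 (hs.hasLead hE j) (Or.inl h))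
  exact ⟨c, hc, by rw [h, smul_mul_assoc]⟩

end Struct

end CGLData

/-! ### Pseudo-division by a normal element of degree one -/

namespace CGLData

variable {K : Type*} [Field K] {R : Type*} [Ring R] [Algebra K R] {N r : ℕ}
  {E : CGLData K R N r} {a b a' b' u v y d : R} {f g : Fin N → ℕ} {m η : Fin r → ℤ} {k : Fin N}

theorem IsCGL.coeff_eq_zero (hE : E.IsCGL) (hv : HasLead K E.x v f) (hf : f k = 1)
    {s : Finset ℕ} {b : ℕ → R} (hb : ∀ i ∈ s, b i ∈ E.sub (k : ℕ))
    (h : ∑ i ∈ s, b i * v ^ i = 0) : ∀ i ∈ s, b i = 0 := by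
  classical
  by_contra! hne
  obtain ⟨i₀, hi₀, hb₀⟩ := hne
  have hl : ∀ i, ∃ f, b i ≠ 0 → HasLead K E.x (b i) f := fun i => by
    by_cases h0 : b i = 0
    · exact ⟨0, fun h => absurd h0 h⟩
    · obtain ⟨f, hf⟩ := hE.exists_hasLead h0
      exact ⟨f, fun _ => hf⟩
  choose g hg using hl
  let t := s.filter fun i => b i ≠ 0
  have ht : ∀ i, i ∈ t ↔ i ∈ s ∧ b i ≠ 0 := fun i => Finset.mem_filter
  have hk : ∀ i ∈ t, (g i + i • f) k = i := fun i hi => by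
    have := hE.mem_expBelow k.2.le (hb i ((ht i).mp hi).1) (hg i ((ht i).mp hi).2) k le_rfl
    simp [this, hf]
  obtain ⟨i, -, hi⟩ := HasLead.sum (K := K) (x := E.x) (v := fun i => b i * v ^ i)
    (e := fun i => g i + i • f) (s := t) ⟨i₀, (ht _).mpr ⟨hi₀, hb₀⟩⟩
    (fun i hi => hE.hasLead_mul (hg i ((ht i).mp hi).2) (hE.hasLead_pow hv i))
    (fun i hi j hj hij => by rw [← hk i hi, ← hk j hj]; exact congrFun hij k)
  refine hi.ne_zero hE.linearIndependent ?_
  rw [← h]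
  refine Finset.sum_subset (Finset.filter_subset _ _) fun j hj hjt => ?_
  have : b j = 0 := by
    by_contra h0
    exact hjt ((ht j).mpr ⟨hj, h0⟩)
  rw [this, zero_mul]

theorem hasLead_x (k : Fin N) : HasLead K E.x (E.x k) (Function.update (0 : Fin N → ℕ) k 1) := by
  have := hasLead_mul_pow (E := E) (k := k) 1 (fun _ _ => rfl) (hasLead_xmon E.x 0)
  rwa [xmon_zero, one_mul, pow_one] at this

theorem IsCGL.coeff_x_eq_zero (hE : E.IsCGL) (ha : a ∈ E.sub (k : ℕ)) (hb : b ∈ E.sub (k : ℕ))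
    (h : a + b * E.x k = 0) : a = 0 ∧ b = 0 := by
  have := hE.coeff_eq_zero (k := k) (s := Finset.range 2) (b := fun i => if i = 0 then a else b)
    (hasLead_x k) (by simp) (fun i _ => by split_ifs <;> assumption)
    (by simpa [Finset.sum_range_succ] using h)
  exact ⟨by simpa using this 0 (by simp), by simpa using this 1 (by simp)⟩

theorem IsCGL.coeff_x_eq (hE : E.IsCGL) (ha : a ∈ E.sub (k : ℕ)) (hb : b ∈ E.sub (k : ℕ))
    (ha' : a' ∈ E.sub (k : ℕ)) (hb' : b' ∈ E.sub (k : ℕ))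
    (h : a + b * E.x k = a' + b' * E.x k) : a = a' ∧ b = b' := by
  have := hE.coeff_x_eq_zero (sub_mem ha ha') (sub_mem hb hb')
    (by rw [sub_mul, ← sub_eq_zero_of_eq h]; abel)
  exact ⟨sub_eq_zero.mp this.1, sub_eq_zero.mp this.2⟩

theorem x_mul_of_mem (ha : a ∈ E.A m) :
    E.x k * a = ((tpow (E.h k) m : Kˣ) : K) • (a * E.x k) + E.D k a := by
  rw [x_mul, act_of_mem _ ha, smul_mul_assoc]

/-- `y * x_k - d` is a normal homogeneous element of `R_{k+1}` with `y`, `d` in `R_k`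
and `y` a normal homogeneous element of `R_k` with which it commutes up to a scalar. -/
structure SkewPair (E : CGLData K R N r) (k : Fin N) (y d : R) (η : Fin r → ℤ) : Prop where
  y_mem : y ∈ E.sub (k : ℕ)
  y_ne : y ≠ 0
  y_hom : y ∈ E.A η
  y_norm : Normalizes (E.sub (k : ℕ)) y
  d_mem : d ∈ E.sub (k : ℕ)
  v_hom : y * E.x k - d ∈ E.A (η + E.ρ k)
  v_norm : Normalizes (E.sub ((k : ℕ) + 1)) (y * E.x k - d)
  exists_smul : ∃ q : K, q ≠ 0 ∧ (y * E.x k - d) * y = q • (y * (y * E.x k - d))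

namespace SkewPair

theorem hasLead (hE : E.IsCGL) (h : E.SkewPair k y d η) :
    ∃ f, HasLead K E.x (y * E.x k - d) f ∧ f k = 1 := by
  obtain ⟨f, hf⟩ := hE.exists_hasLead h.y_ne
  have hl := hasLead_mul_pow 1 (hE.mem_expBelow k.2.le h.y_mem hf) hf
  rw [pow_one] at hl
  refine ⟨Function.update f k 1, ?_, Function.update_self ..⟩
  rw [sub_eq_add_neg]
  refine hl.add_mem_lowerSpan (neg_mem (hE.mem_lowerSpan k.2.le h.d_mem fun h' => ?_))
  have := h' k le_rfl
  rw [Function.update_self] at this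
  exact one_ne_zero this

theorem v_ne (hE : E.IsCGL) (h : E.SkewPair k y d η) : y * E.x k - d ≠ 0 := by
  obtain ⟨f, hf, -⟩ := h.hasLead hE
  exact hf.ne_zero hE.linearIndependent

theorem v_norm' (hE : E.IsCGL) (h : E.SkewPair k y d η) :
    Normalizes (E.sub (k : ℕ)) (y * E.x k - d) :=
  hE.normalizes_mono (Nat.le_succ _) k.2.le (h.v_ne hE) h.v_norm

theorem mul_eq_smul (hE : E.IsCGL) (h : E.SkewPair k y d η) (ha : a ∈ E.sub (k : ℕ))
    (ha' : a' ∈ E.sub (k : ℕ)) (hm : a ∈ E.A m)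
    (heq : (y * E.x k - d) * a = a' * (y * E.x k - d)) :
    a' * y = ((tpow (E.h k) m : Kˣ) : K) • (y * a) := by
  have h₁ : (y * E.D k a - d * a) + (((tpow (E.h k) m : Kˣ) : K) • (y * a)) * E.x k =
      - (a' * d) + (a' * y) * E.x k := by
    have h₂ : (y * E.x k - d) * a =
        (y * E.D k a - d * a) + (((tpow (E.h k) m : Kˣ) : K) • (y * a)) * E.x k := by
      rw [sub_mul, mul_assoc, x_mul_of_mem hm, mul_add, mul_smul_comm, smul_mul_assoc, mul_assoc]
      abel
    rw [← h₂, heq, mul_sub, mul_assoc]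
    abel
  exact (hE.coeff_x_eq
    (sub_mem (mul_mem h.y_mem (hE.delta_stab k a ha)) (mul_mem h.d_mem ha))
    (Subalgebra.smul_mem _ (mul_mem h.y_mem ha) _)
    (neg_mem (mul_mem ha' h.d_mem)) (mul_mem ha' h.y_mem) h₁).2.symm

theorem v_mul_y (hE : E.IsCGL) (h : E.SkewPair k y d η) :
    (y * E.x k - d) * y = ((tpow (E.h k) η : Kˣ) : K) • (y * (y * E.x k - d)) := by
  have := hE.noZeroDivisors
  obtain ⟨q, _, hq'⟩ := h.exists_smul
  have h₁ := h.mul_eq_smul hE h.y_mem (Subalgebra.smul_mem _ h.y_mem q) h.y_hom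
    (by rw [hq', smul_mul_assoc])
  rw [smul_mul_assoc] at h₁
  rw [hq', smul_left_injective K (mul_ne_zero h.y_ne h.y_ne) h₁]

theorem pow_mul_y (hE : E.IsCGL) (h : E.SkewPair k y d η) (i : ℕ) :
    (y * E.x k - d) ^ i * y =
      ((tpow (E.h k) η : Kˣ) : K) ^ i • (y * (y * E.x k - d) ^ i) := by
  induction i with
  | zero => simp
  | succ i ih =>
    rw [pow_succ (y * E.x k - d), mul_assoc, h.v_mul_y hE, mul_smul_comm, ← mul_assoc, ih,
      smul_mul_assoc, smul_smul, mul_assoc, ← pow_succ']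

theorem v_mul_pow (hE : E.IsCGL) (h : E.SkewPair k y d η) (i : ℕ) :
    (y * E.x k - d) * y ^ i =
      ((tpow (E.h k) η : Kˣ) : K) ^ i • (y ^ i * (y * E.x k - d)) := by
  induction i with
  | zero => simp
  | succ i ih =>
    rw [pow_succ y, ← mul_assoc, ih, smul_mul_assoc, mul_assoc, h.v_mul_y hE, mul_smul_comm,
      smul_smul, mul_assoc, ← pow_succ]

/-- The span of the elements `a * v^i` with `a ∈ R_{k-1}`. -/
def vSpan (E : CGLData K R N r) (k : Fin N) (v : R) : Submodule K R :=
  Submodule.span K {z | ∃ a ∈ E.sub (k : ℕ), ∃ i : ℕ, z = a * v ^ i}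

theorem mul_mem_vSpan (ha : a ∈ E.sub (k : ℕ)) (hb : b ∈ vSpan E k v) : a * b ∈ vSpan E k v := by
  induction hb using Submodule.span_induction with
  | mem z hz =>
    obtain ⟨c, hc, i, rfl⟩ := hz
    exact Submodule.subset_span ⟨a * c, mul_mem ha hc, i, by rw [mul_assoc]⟩
  | zero => simp
  | add y z _ _ hy hz => rw [mul_add]; exact add_mem hy hz
  | smul t z _ hz => rw [mul_smul_comm]; exact Submodule.smul_mem _ _ hz

theorem exists_eq_sum_of_mem_vSpan (h : a ∈ vSpan E k v) :
    ∃ (s : Finset ℕ) (b : ℕ → R), (∀ i ∈ s, b i ∈ E.sub (k : ℕ)) ∧ a = ∑ i ∈ s, b i * v ^ i := by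
  suffices h' : ∃ b : ℕ →₀ R, (∀ i, b i ∈ E.sub (k : ℕ)) ∧ a = b.sum fun i c => c * v ^ i by
    obtain ⟨b, hb, rfl⟩ := h'
    exact ⟨b.support, b, fun i _ => hb i, rfl⟩
  induction h using Submodule.span_induction with
  | mem z hz =>
    obtain ⟨c, hc, i, rfl⟩ := hz
    refine ⟨Finsupp.single i c, fun j => ?_, by simp⟩
    rw [Finsupp.single_apply]
    split_ifs
    exacts [hc, zero_mem _]
  | zero => exact ⟨0, fun _ => zero_mem _, by simp⟩
  | add y z _ _ hy hz =>
    obtain ⟨b, hb, rfl⟩ := hy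
    obtain ⟨c, hc, rfl⟩ := hz
    exact ⟨b + c, fun i => add_mem (hb i) (hc i),
      (Finsupp.sum_add_index' (by simp) fun _ _ _ => add_mul _ _ _).symm⟩
  | smul t z _ hz =>
    obtain ⟨b, hb, rfl⟩ := hz
    refine ⟨t • b, fun i => Subalgebra.smul_mem _ (hb i) t, ?_⟩
    rw [Finsupp.sum_smul_index' (by simp), Finsupp.smul_sum]
    simp only [smul_mul_assoc]

theorem mul_mul_mem_vSpan (hE : E.IsCGL) (h : E.SkewPair k y d η)
    (ha : a ∈ vSpan E k (y * E.x k - d)) : y * a * E.x k ∈ vSpan E k (y * E.x k - d) := by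
  induction ha using Submodule.span_induction with
  | mem z hz =>
    obtain ⟨b, hb, i, rfl⟩ := hz
    obtain ⟨b', hb', h₁⟩ := h.y_norm.1 b hb
    obtain ⟨d', hd', h₂⟩ := ((h.v_norm' hE).pow i).1 d h.d_mem
    have h₃ := h.pow_mul_y hE i
    have hq : ((tpow (E.h k) η : Kˣ) : K) ^ i ≠ 0 := pow_ne_zero _ (Units.ne_zero _)
    have h₄ : y * (y * E.x k - d) ^ i * E.x k = (((tpow (E.h k) η : Kˣ) : K) ^ i)⁻¹ •
        (1 * (y * E.x k - d) ^ (i + 1) + d' * (y * E.x k - d) ^ i) := by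
      rw [eq_inv_smul_iff₀ hq, ← smul_mul_assoc, ← h₃, ← h₂, one_mul, pow_succ (y * E.x k - d) i,
        ← mul_add, sub_add_cancel, mul_assoc]
    rw [← mul_assoc, h₁, mul_assoc, mul_assoc, ← mul_assoc y, h₄]
    exact mul_mem_vSpan hb' (Submodule.smul_mem _ _ (add_mem
      (Submodule.subset_span ⟨1, one_mem _, _, rfl⟩)
      (Submodule.subset_span ⟨d', hd', _, rfl⟩)))
  | zero => simp
  | add y z _ _ hy hz => rw [mul_add, add_mul]; exact add_mem hy hz
  | smul t z _ hz => rw [mul_smul_comm, smul_mul_assoc]; exact Submodule.smul_mem _ _ hz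

theorem pow_mul_pow_mem_vSpan (hE : E.IsCGL) (h : E.SkewPair k y d η) (i : ℕ) :
    y ^ i * E.x k ^ i ∈ vSpan E k (y * E.x k - d) := by
  induction i with
  | zero => exact Submodule.subset_span ⟨1, one_mem _, 0, by simp⟩
  | succ i ih =>
    rw [pow_succ' y, pow_succ (E.x k), mul_assoc, ← mul_assoc (y ^ i), ← mul_assoc]
    exact h.mul_mul_mem_vSpan hE ih

theorem exists_pow_mul_mem_vSpan (hE : E.IsCGL) (h : E.SkewPair k y d η)
    (hu : u ∈ E.sub ((k : ℕ) + 1)) : ∃ M : ℕ, y ^ M * u ∈ vSpan E k (y * E.x k - d) := by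
  obtain ⟨n, hn⟩ := hE.exists_mem_skewSpan hu
  clear hu
  induction hn using Submodule.span_induction with
  | mem z hz =>
    obtain ⟨c, hc, i, _, rfl⟩ := hz
    obtain ⟨c', hc', h₁⟩ := (h.y_norm.pow i).1 c hc
    refine ⟨i, ?_⟩
    rw [← mul_assoc, h₁, mul_assoc]
    exact mul_mem_vSpan hc' (h.pow_mul_pow_mem_vSpan hE i)
  | zero => exact ⟨0, by simp⟩
  | add z w _ _ hz hw =>
    obtain ⟨M, hM⟩ := hz
    obtain ⟨M', hM'⟩ := hw
    refine ⟨M + M', ?_⟩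
    rw [mul_add]
    refine add_mem ?_ ?_
    · rw [add_comm M, pow_add, mul_assoc]
      exact mul_mem_vSpan (pow_mem h.y_mem _) hM
    · rw [pow_add, mul_assoc]
      exact mul_mem_vSpan (pow_mem h.y_mem _) hM'
  | smul t z _ hz =>
    obtain ⟨M, hM⟩ := hz
    exact ⟨M, by rw [mul_smul_comm]; exact Submodule.smul_mem _ _ hM⟩

theorem eq_single_of_quasi_commute (hE : E.IsCGL) (h : E.SkewPair k y d η) {w : R}
    {ω : Fin r → ℤ} (hw0 : w ≠ 0) (hω : w ∈ E.A ω) (hw : w ∈ vSpan E k (y * E.x k - d))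
    {c c' : K} (hc : c ≠ 0) (hy : w * y = c • (y * w))
    (hv : w * (y * E.x k - d) = c' • ((y * E.x k - d) * w)) :
    ∃ b ∈ E.sub (k : ℕ), (∃ m, b ∈ E.A m) ∧ ∃ i : ℕ, w = b * (y * E.x k - d) ^ i := by
  have := hE.noZeroDivisors
  obtain ⟨s, b₀, hb₀, hwb₀⟩ := exists_eq_sum_of_mem_vSpan hw
  obtain ⟨fv, hfv, hfv1⟩ := h.hasLead hE
  have hpow := h.pow_mul_y hE
  have hvn := h.v_norm' hE
  have hR1 := fun a a' m => h.mul_eq_smul hE (a := a) (a' := a') (m := m)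
  have hvh := h.v_hom
  have hv0 := h.v_ne hE
  set v := y * E.x k - d with hvdef
  set ν := η + E.ρ k with hν
  let b : ℕ → R := fun i => E.proj (ω - i • ν) (b₀ i)
  have hb : ∀ i ∈ s, b i ∈ E.sub (k : ℕ) := fun i hi => proj_mem_sub hE k.2.le (hb₀ i hi)
  have hbA : ∀ i, b i ∈ E.A (ω - i • ν) := fun i => proj_mem _
  have hwb : w = ∑ i ∈ s, b i * v ^ i := by
    rw [← proj_of_mem hω, hwb₀, map_sum]
    refine Finset.sum_congr rfl fun i _ => ?_
    rw [← proj_mul_right (pow_mem_A hvh i), sub_add_cancel]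
  have hy' : ∀ i ∈ s, ((tpow (E.h k) η : Kˣ) : K) ^ i • (b i * y) = c • (y * b i) := by
    have h0 : ∑ i ∈ s, (((tpow (E.h k) η : Kˣ) : K) ^ i • (b i * y) - c • (y * b i)) * v ^ i
        = 0 := by
      simp only [sub_mul, Finset.sum_sub_distrib]
      rw [sub_eq_zero]
      trans w * y
      · rw [hwb, Finset.sum_mul]
        refine Finset.sum_congr rfl fun i _ => ?_
        rw [mul_assoc, hpow, smul_mul_assoc, mul_smul_comm, mul_assoc]
      · rw [hy, hwb, Finset.mul_sum, Finset.smul_sum]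
        exact Finset.sum_congr rfl fun i _ => by rw [smul_mul_assoc, mul_assoc]
    intro i hi
    refine sub_eq_zero.mp (hE.coeff_eq_zero hfv hfv1 (fun i hi => ?_) h0 i hi)
    exact sub_mem (Subalgebra.smul_mem _ (mul_mem (hb i hi) h.y_mem) _)
      (Subalgebra.smul_mem _ (mul_mem h.y_mem (hb i hi)) _)
  have hβ : ∀ i, ∃ β, i ∈ s → β ∈ E.sub (k : ℕ) ∧ v * b i = β * v := fun i => by
    by_cases hi : i ∈ s
    · obtain ⟨β, h₁, h₂⟩ := hvn.1 (b i) (hb i hi)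
      exact ⟨β, fun _ => ⟨h₁, h₂⟩⟩
    · exact ⟨0, fun h => absurd h hi⟩
  choose β hβ using hβ
  have hv' : ∀ i ∈ s, b i = c' • β i := by
    have h0 : ∑ i ∈ s, (b i - c' • β i) * v ^ i = 0 := by
      refine (mul_eq_zero.mp ?_).resolve_right hv0
      simp only [sub_mul, Finset.sum_sub_distrib]
      rw [sub_eq_zero]
      trans w * v
      · rw [hwb]
      · rw [hv, hwb, Finset.mul_sum, Finset.smul_sum, Finset.sum_mul]
        refine Finset.sum_congr rfl fun i hi => ?_
        rw [← mul_assoc, (hβ i hi).2, smul_mul_assoc, smul_mul_assoc, mul_assoc, mul_assoc,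
          ← pow_succ, ← pow_succ']
    intro i hi
    refine sub_eq_zero.mp (hE.coeff_eq_zero hfv hfv1 (fun i hi => ?_) h0 i hi)
    exact sub_mem (hb i hi) (Subalgebra.smul_mem _ (hβ i hi).1 _)
  have hkey : ∀ i ∈ s, b i ≠ 0 → c' * ((tpow (E.h k) ω : Kˣ) : K) =
      c * ((tpow (E.h k) (E.ρ k) : Kˣ) : K) ^ i := by
    intro i hi hi0
    have h₁ := hR1 (b i) (β i) _ (hb i hi) (hβ i hi).1 (hbA i) (hβ i hi).2
    have h₂ := hy' i hi
    nth_rewrite 1 [hv' i hi] at h₂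
    rw [smul_mul_assoc, h₁, smul_smul, smul_smul] at h₂
    have h₃ := smul_left_injective K (mul_ne_zero h.y_ne hi0) h₂
    have h₄ : ((tpow (E.h k) ω : Kˣ) : K) = ((tpow (E.h k) (ω - i • ν) : Kˣ) : K) *
        (((tpow (E.h k) η : Kˣ) : K) * ((tpow (E.h k) (E.ρ k) : Kˣ) : K)) ^ i := by
      rw [← Units.val_mul, ← tpow_add, ← Units.val_pow_eq_pow_val, ← tpow_nsmul, ← Units.val_mul,
        ← tpow_add, ← hν, sub_add_cancel]
    rw [h₄, ← h₃]
    ring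
  obtain ⟨i, hi, hi0⟩ : ∃ i ∈ s, b i ≠ 0 := by
    by_contra! hall
    refine hw0 ?_
    rw [hwb]
    exact Finset.sum_eq_zero fun i hi => by rw [hall i hi, zero_mul]
  refine ⟨b i, hb i hi, ⟨_, hbA i⟩, i, ?_⟩
  rw [hwb]
  refine Finset.sum_eq_single_of_mem i hi fun j hj hij => ?_
  by_cases hj0 : b j = 0
  · rw [hj0, zero_mul]
  exfalso
  have h₁ : tpow (E.h k) (E.ρ k) ^ j = tpow (E.h k) (E.ρ k) ^ i := by
    refine Units.ext ?_
    rw [Units.val_pow_eq_pow_val, Units.val_pow_eq_pow_val]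
    exact mul_left_cancel₀ hc ((hkey j hj hj0).symm.trans (hkey i hi hi0))
  have hfin : ¬ IsOfFinOrder (tpow (E.h k) (E.ρ k)) := fun hf => by
    obtain ⟨n, hn, hn'⟩ := isOfFinOrder_iff_pow_eq_one.mp hf
    exact hE.notroot k n hn hn'
  exact hij (injective_pow_iff_not_isOfFinOrder.mpr hfin h₁)

/-- A homogeneous normal element of `R_{k+1}` becomes a multiple of a power of
`v = y * x_k - d` by an element of `R_k` after multiplication by a power of `y`. -/
theorem exists_pow_mul_eq (hE : E.IsCGL) (h : E.SkewPair k y d η) {ω : Fin r → ℤ} (hu0 : u ≠ 0)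
    (hu : u ∈ E.sub ((k : ℕ) + 1)) (hω : u ∈ E.A ω) {c c' : K} (hc : c ≠ 0)
    (hy : u * y = c • (y * u))
    (hv : u * (y * E.x k - d) = c' • ((y * E.x k - d) * u)) :
    ∃ M : ℕ, ∃ b ∈ E.sub (k : ℕ), (∃ m, b ∈ E.A m) ∧
      ∃ i : ℕ, y ^ M * u = b * (y * E.x k - d) ^ i := by
  have := hE.noZeroDivisors
  obtain ⟨M, hM⟩ := h.exists_pow_mul_mem_vSpan hE hu
  have hq : ((tpow (E.h k) η : Kˣ) : K) ^ M ≠ 0 := pow_ne_zero _ (Units.ne_zero _)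
  refine ⟨M, h.eq_single_of_quasi_commute hE (mul_ne_zero (pow_ne_zero _ h.y_ne) hu0)
    (mul_mem_A (pow_mem_A h.y_hom M) hω) hM hc
    (c' := c' * (((tpow (E.h k) η : Kˣ) : K) ^ M)⁻¹) ?_ ?_⟩
  · rw [mul_assoc, hy, mul_smul_comm, ← mul_assoc, ← mul_assoc, ← pow_succ, ← pow_succ']
  · rw [mul_assoc, hv, mul_smul_comm, ← mul_assoc (y * E.x k - d), h.v_mul_pow hE,
      smul_mul_assoc, smul_smul, mul_assoc c', inv_mul_cancel₀ hq, mul_one, mul_assoc]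

end SkewPair

end CGLData

/-! ### Pairs of prime elements -/

namespace CGLData

variable {K : Type*} [Field K] {R : Type*} [Ring R] [Algebra K R] {N r : ℕ}
  {E : CGLData K R N r} {a b u v y d : R} {f g : Fin N → ℕ} {m m' η : Fin r → ℤ} {k : Fin N}

theorem mem_A_of_mul_right [NoZeroDivisors R] (hb : b ∈ E.A m') (hb0 : b ≠ 0)
    (h : a * b ∈ E.A m) : a ∈ E.A (m - m') := by
  refine mem_A_of_forall fun s hs => ?_
  by_contra hne
  have h₁ := proj_of_mem_ne (m' := s + m') h fun h' => hne (by rw [h', add_sub_cancel_right])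
  rw [proj_mul_right hb] at h₁
  exact mul_ne_zero hs hb0 h₁

theorem mem_sub_of_mem_lowerSpan_single (ha : a ∈ lowerSpan K E.x (Function.update 0 k 1)) :
    a ∈ E.sub (k : ℕ) := by
  have : lowerSpan K E.x (Function.update 0 k 1) ≤ Subalgebra.toSubmodule (E.sub k) := by
    refine Submodule.span_le.mpr ?_
    rintro _ ⟨g, ⟨l, hl, hl'⟩, rfl⟩
    have hlk : l = k := by
      by_contra h
      rw [Function.update_of_ne h] at hl
      exact Nat.not_lt_zero _ hl
    subst hlk
    refine xmon_mem_sub fun j hj => ?_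
    rcases eq_or_lt_of_le (Fin.le_def.mpr hj) with rfl | h
    · rw [Function.update_self] at hl
      omega
    · rw [hl' j h, Function.update_of_ne h.ne', Pi.zero_apply]
  exact this ha

namespace SkewPair

theorem v_notMem (hE : E.IsCGL) (h : E.SkewPair k y d η) : y * E.x k - d ∉ E.sub (k : ℕ) := by
  intro hv
  have h₁ : (-d - (y * E.x k - d)) + y * E.x k = 0 := by abel
  exact h.y_ne (hE.coeff_x_eq_zero (sub_mem (neg_mem h.d_mem) hv) h.y_mem h₁).2

theorem d_hom (hE : E.IsCGL) (h : E.SkewPair k y d η) : d ∈ E.A (η + E.ρ k) := by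
  have := sub_mem (mul_mem_A h.y_hom (hE.xhom k)) h.v_hom
  rwa [sub_sub_cancel] at this

theorem exists_mem_of_eq_mul (hE : E.IsCGL) (h : E.SkewPair k y d η) {s : R}
    (hs : y * s ∈ E.sub (k : ℕ)) : s ∈ E.sub (k : ℕ) := by
  by_cases hs0 : s = 0
  · rw [hs0]
    exact zero_mem _
  · exact (hE.mem_sub_of_mul k.2.le h.y_ne hs0 hs).2

variable (hyp : IsPrimeElemIn (E.sub (k : ℕ) : Set R) y)
  (hvp : IsPrimeElemIn (E.sub ((k : ℕ) + 1) : Set R) (y * E.x k - d))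

include hyp hvp

theorem not_dvd (hE : E.IsCGL) (h : E.SkewPair k y d η) :
    ¬ ∃ e ∈ E.sub (k : ℕ), d = e * y := by
  have := hE.noZeroDivisors
  rintro ⟨e, he, hd⟩
  obtain ⟨d₁, hd₁, hd'⟩ := h.y_norm.2 e he
  have hv : y * E.x k - d = y * (E.x k - d₁) := by rw [hd, hd', mul_sub]
  have hle : E.sub (k : ℕ) ≤ E.sub ((k : ℕ) + 1) := sub_mono (Nat.le_succ _)
  have hv0 := h.v_ne hE
  have hx0 : E.x k - d₁ ≠ 0 := by
    intro h0
    rw [h0, mul_zero] at hv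
    exact hv0 hv
  rcases hvp.2.2.2.2 y (hle h.y_mem) (E.x k - d₁)
    (sub_mem (x_mem_sub (Nat.lt_succ_self _)) (hle hd₁)) ⟨1, one_mem _, by rw [one_mul, hv]⟩
    with ⟨s, -, hs⟩ | ⟨s, -, hs⟩
  · have hs0 : s ≠ 0 := by
      rintro rfl
      rw [zero_mul] at hs
      exact h.y_ne hs
    exact h.v_notMem hE (hE.mem_sub_of_mul k.2.le hs0 hv0 (hs ▸ h.y_mem)).2
  · rw [hv, ← mul_assoc] at hs
    have h1 : s * y = 1 := mul_right_cancel₀ hx0 (by rw [← hs, one_mul])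
    have hs0 : s ≠ 0 := by
      rintro rfl
      rw [zero_mul, zero_mul] at hs
      exact hx0 hs
    exact hyp.2.2.2.1 ⟨s, (hE.mem_sub_of_mul k.2.le hs0 h.y_ne (h1 ▸ one_mem _)).1, h1.symm⟩

theorem exists_eq_mul_of_mul_pow (hE : E.IsCGL) (h : E.SkewPair k y d η) {i : ℕ} {s : R}
    (hb : b ∈ E.sub (k : ℕ)) (hs : b * (y * E.x k - d) ^ i = y * s) :
    ∃ e ∈ E.sub (k : ℕ), b = y * e := by
  have := hE.noZeroDivisors
  induction i generalizing b s with
  | zero =>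
    rw [pow_zero, mul_one] at hs
    exact ⟨s, h.exists_mem_of_eq_mul hE (hs ▸ hb), hs⟩
  | succ i ih =>
    have hq : ((tpow (E.h k) η : Kˣ) : K) ^ i ≠ 0 := pow_ne_zero _ (Units.ne_zero _)
    have hpow := h.pow_mul_y hE i
    have hvi := (h.v_norm' hE).pow i
    have hvi0 : (y * E.x k - d) ^ i ≠ 0 := pow_ne_zero _ (h.v_ne hE)
    obtain ⟨d', hd', h₁⟩ := hvi.1 d h.d_mem
    obtain ⟨b', _, h₂⟩ := h.y_norm.2 b hb
    have h₃ : b * d' * (y * E.x k - d) ^ i = y *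
        (((tpow (E.h k) η : Kˣ) : K) ^ i • (b' * (y * E.x k - d) ^ i * E.x k) - s) := by
      have h₄ : b * (y * E.x k - d) ^ (i + 1) =
          ((tpow (E.h k) η : Kˣ) : K) ^ i • (y * (b' * (y * E.x k - d) ^ i * E.x k))
            - b * d' * (y * E.x k - d) ^ i := by
        rw [pow_succ]
        rw [mul_sub ((y * E.x k - d) ^ i), ← mul_assoc ((y * E.x k - d) ^ i), hpow, h₁, mul_sub b,
          smul_mul_assoc, mul_smul_comm, ← mul_assoc b d', ← mul_assoc b, ← mul_assoc b, h₂]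
        simp only [mul_assoc]
      rw [mul_sub, ← hs, h₄, mul_smul_comm]
      abel
    obtain ⟨e, he, h₄⟩ := ih (mul_mem hb hd') h₃
    obtain ⟨e', he', h₅⟩ := h.y_norm.1 e he
    rcases hyp.2.2.2.2 b hb d' hd' ⟨e', he', h₄.trans h₅⟩ with ⟨c, hc, h₆⟩ | ⟨c, hc, h₆⟩
    · obtain ⟨c', hc', h₇⟩ := h.y_norm.2 c hc
      exact ⟨c', hc', h₆.trans h₇⟩
    · exfalso
      obtain ⟨c', hc', h₇⟩ := hvi.2 c hc
      refine h.not_dvd hyp hvp hE ⟨(((tpow (E.h k) η : Kˣ) : K) ^ i)⁻¹ • c',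
        Subalgebra.smul_mem _ hc' _, mul_left_cancel₀ hvi0 ?_⟩
      rw [h₁, h₆, smul_mul_assoc, mul_smul_comm, ← mul_assoc, ← h₇, mul_assoc, mul_assoc c, hpow,
        mul_smul_comm, inv_smul_smul₀ hq]

theorem exists_eq_of_pow_mul_eq (hE : E.IsCGL) (h : E.SkewPair k y d η) {i M : ℕ}
    (hb : b ∈ E.sub (k : ℕ)) (hu : y ^ M * u = b * (y * E.x k - d) ^ i) :
    ∃ b ∈ E.sub (k : ℕ), u = b * (y * E.x k - d) ^ i := by
  have := hE.noZeroDivisors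
  induction M generalizing b with
  | zero => exact ⟨b, hb, by rw [← hu, pow_zero, one_mul]⟩
  | succ M ih =>
    rw [pow_succ', mul_assoc] at hu
    obtain ⟨e, he, rfl⟩ := h.exists_eq_mul_of_mul_pow hyp hvp hE hb hu.symm
    exact ih he (mul_left_cancel₀ h.y_ne (by rw [hu, mul_assoc]))

omit hyp hvp in
/-- The multiples of `y` in `R_{k-1}`. -/
def yIdeal (E : CGLData K R N r) (k : Fin N) (y : R) : Submodule K R :=
  (Subalgebra.toSubmodule (E.sub (k : ℕ))).map (LinearMap.mulLeft K y)

omit hyp hvp in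
theorem mem_yIdeal : a ∈ yIdeal E k y ↔ ∃ e ∈ E.sub (k : ℕ), a = y * e := by
  simp only [yIdeal, Submodule.mem_map, Subalgebra.mem_toSubmodule, LinearMap.mulLeft_apply,
    eq_comm]

omit hyp hvp in
theorem mul_mem_yIdeal (h : E.SkewPair k y d η) (ha : a ∈ E.sub (k : ℕ)) :
    a * y ∈ yIdeal E k y := by
  obtain ⟨e, he, h₁⟩ := h.y_norm.2 a ha
  exact mem_yIdeal.mpr ⟨e, he, h₁⟩

omit hyp hvp in
theorem exists_d_mul_y (hE : E.IsCGL) (h : E.SkewPair k y d η) :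
    ∃ d₁ ∈ E.sub (k : ℕ), d * y = y * d₁ ∧
      d₁ - (((tpow (E.h k) η : Kˣ) : K) * ((tpow (E.h k) (E.ρ k) : Kˣ) : K)) • d
        ∈ yIdeal E k y := by
  have := hE.noZeroDivisors
  obtain ⟨d₁, hd₁, h₁⟩ := h.y_norm.2 d h.d_mem
  refine ⟨d₁, hd₁, h₁, ?_⟩
  have hχ : ((tpow (E.h k) (η + E.ρ k) : Kˣ) : K) =
      ((tpow (E.h k) η : Kˣ) : K) * ((tpow (E.h k) (E.ρ k) : Kˣ) : K) := by
    rw [tpow_add, Units.val_mul]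
  have hxd := x_mul_of_mem (k := k) (h.d_hom hE)
  have hxy := x_mul_of_mem (k := k) h.y_hom
  have hδy := hE.delta_stab k y h.y_mem
  have hδd := hE.delta_stab k d h.d_mem
  rw [hχ] at hxd
  have hvy := h.v_mul_y hE
  have hq0 : ((tpow (E.h k) η : Kˣ) : K) ≠ 0 := Units.ne_zero _
  set q : K := ((tpow (E.h k) η : Kˣ) : K) with hq
  set l : K := ((tpow (E.h k) (E.ρ k) : Kˣ) : K) with hl
  have hδ : E.D k y = d₁ - q • d := by
    refine mul_left_cancel₀ h.y_ne ?_
    rw [sub_mul, mul_assoc, hxy, h₁, mul_add, mul_smul_comm, mul_sub, smul_sub] at hvy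
    rw [mul_sub, mul_smul_comm]
    have := sub_eq_zero_of_eq hvy
    rw [← sub_eq_zero, ← this]
    abel
  obtain ⟨t, _, ht⟩ := h.v_norm.1 (E.x k) (x_mem_sub (Nat.lt_succ_self _))
  obtain ⟨c, -, t₀, ht₀, rfl⟩ := hE.hasLead_of_intertwine (h.v_ne hE) (hasLead_x k) (Or.inl ht)
  have ht₀' := mem_sub_of_mem_lowerSpan_single ht₀
  have hx1 : xmon E.x (Function.update (0 : Fin N → ℕ) k 1) = E.x k := by
    rw [← xmon_mul_pow E.x k 0 (fun _ _ => rfl) 1, xmon_zero, one_mul, pow_one]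
  rw [hx1] at ht
  have hexp : (- (c • E.D k d) - t₀ * d) * E.x k ^ 0
      + (c • E.D k y - c • (q * l) • d + t₀ * y + d) * E.x k ^ 1
      + (c • q • y - y) * E.x k ^ 2 = 0 := by
    have e1 : (y * E.x k - d) * E.x k = y * E.x k ^ 2 - d * E.x k := by
      rw [sub_mul, mul_assoc, ← pow_two]
    have e2 : (c • E.x k + t₀) * (y * E.x k - d) =
        c • (q • (y * E.x k ^ 2) + E.D k y * E.x k) - c • ((q * l) • (d * E.x k) + E.D k d)
          + t₀ * y * E.x k - t₀ * d := by
      rw [add_mul, mul_sub, mul_sub, smul_mul_assoc, smul_mul_assoc, hxd, ← mul_assoc (E.x k), hxy,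
        add_mul, smul_mul_assoc, mul_assoc y, ← pow_two, mul_assoc t₀]
      abel
    have e3 := sub_eq_zero_of_eq (e2.symm.trans (ht.symm.trans e1))
    rw [← e3]
    simp only [pow_zero, mul_one, pow_one, sub_mul, add_mul, smul_mul_assoc, smul_add]
    abel
  have hco := hE.coeff_eq_zero (k := k) (s := Finset.range 3)
    (b := fun i => if i = 0 then - (c • E.D k d) - t₀ * d else
      if i = 1 then c • E.D k y - c • (q * l) • d + t₀ * y + d else c • q • y - y)
    (hasLead_x k) (by simp) (fun i _ => by
      have hy := h.y_mem
      have hd := h.d_mem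
      split_ifs
      · exact sub_mem (neg_mem (Subalgebra.smul_mem _ hδd _)) (mul_mem ht₀' hd)
      · exact add_mem (add_mem (sub_mem (Subalgebra.smul_mem _ hδy _) (Subalgebra.smul_mem _
          (Subalgebra.smul_mem _ hd _) _)) (mul_mem ht₀' hy)) hd
      · exact sub_mem (Subalgebra.smul_mem _ (Subalgebra.smul_mem _ hy _) _) hy)
    (by simpa [Finset.sum_range_succ] using hexp)
  have hc1 := hco 1 (by simp)
  have hc2 := hco 2 (by simp)
  simp only [one_ne_zero, OfNat.ofNat_ne_zero, OfNat.ofNat_ne_one, if_false, if_true] at hc1 hc2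
  have hcq : c * q = 1 := by
    refine smul_left_injective K h.y_ne ?_
    simpa [mul_smul] using sub_eq_zero.mp hc2
  have hcq' : q * c = 1 := by rw [mul_comm, hcq]
  have h₂ : q • (c • E.D k y - c • (q * l) • d + t₀ * y + d) = 0 := by rw [hc1, smul_zero]
  have h₃ : d₁ - (q * l) • d = - (q • (t₀ * y)) := by
    rw [smul_add, smul_add, smul_sub, smul_smul, smul_smul, hcq', one_smul, one_smul, hδ] at h₂
    rw [← sub_eq_zero, ← h₂]
    abel
  rw [h₃]
  exact neg_mem (Submodule.smul_mem _ _ (h.mul_mem_yIdeal ht₀'))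

omit hyp hvp in
theorem exists_d_mul_pow (hE : E.IsCGL) (h : E.SkewPair k y d η) (i : ℕ) :
    ∃ d' : R, d * y ^ i = y ^ i * d' ∧
      d' - (((tpow (E.h k) η : Kˣ) : K) * ((tpow (E.h k) (E.ρ k) : Kˣ) : K)) ^ i • d
        ∈ yIdeal E k y := by
  obtain ⟨d₁, hd₁, h₁, h₂⟩ := h.exists_d_mul_y hE
  induction i with
  | zero => exact ⟨d, by simp, by simp⟩
  | succ i ih =>
    obtain ⟨d', h₃, h₄⟩ := ih
    obtain ⟨e, he, h₅⟩ := mem_yIdeal.mp h₄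
    set p : K := ((tpow (E.h k) η : Kˣ) : K) * ((tpow (E.h k) (E.ρ k) : Kˣ) : K)
    rw [sub_eq_iff_eq_add] at h₅
    refine ⟨e * y + p ^ i • d₁, ?_, ?_⟩
    · rw [pow_succ, ← mul_assoc, h₃, h₅, mul_assoc, add_mul, smul_mul_assoc, h₁, mul_assoc y e,
        mul_assoc (y ^ i)]
      simp only [mul_add, mul_smul_comm]
    · have : e * y + p ^ i • d₁ - p ^ (i + 1) • d = e * y + p ^ i • (d₁ - p • d) := by
        rw [smul_sub, smul_smul, ← pow_succ]
        abel
      rw [this]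
      exact add_mem (h.mul_mem_yIdeal he) (Submodule.smul_mem _ _ h₂)

/-- No positive power of `y` is normal in `R_k`. -/
theorem not_normalizes_pow (hE : E.IsCGL) (h : E.SkewPair k y d η) {i : ℕ} (hi : 1 ≤ i) :
    ¬ Normalizes (E.sub ((k : ℕ) + 1)) (y ^ i) := by
  have := hE.noZeroDivisors
  intro hn
  obtain ⟨s, _, hs⟩ := hn.2 (E.x k) (x_mem_sub (Nat.lt_succ_self _))
  obtain ⟨d', h₁, h₂⟩ := h.exists_d_mul_pow hE i
  have h₃ := h.v_mul_pow hE i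
  have hq0 : ((tpow (E.h k) η : Kˣ) : K) ≠ 0 := Units.ne_zero _
  have hroot := hE.notroot k i hi
  set q : K := ((tpow (E.h k) η : Kˣ) : K) with hq
  have h₄ : d' - q ^ i • d = y * (s - q ^ i • E.x k) := by
    refine mul_left_cancel₀ (pow_ne_zero i h.y_ne) ?_
    rw [sub_mul, mul_assoc, hs, h₁, ← mul_assoc, ← pow_succ', pow_succ, mul_assoc, mul_sub,
      smul_sub] at h₃
    rw [mul_sub, mul_sub y, mul_sub, mul_smul_comm, mul_smul_comm, mul_smul_comm,
      ← sub_eq_zero, ← sub_eq_zero_of_eq h₃.symm]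
    abel
  have hd' : d' ∈ E.sub (k : ℕ) := by
    obtain ⟨e, he, h₅⟩ := mem_yIdeal.mp h₂
    rw [sub_eq_iff_eq_add] at h₅
    rw [h₅]
    exact add_mem (mul_mem h.y_mem he) (Subalgebra.smul_mem _ h.d_mem _)
  have h₅ : d' - q ^ i • d ∈ yIdeal E k y :=
    mem_yIdeal.mpr ⟨_, h.exists_mem_of_eq_mul hE
      (h₄ ▸ sub_mem hd' (Subalgebra.smul_mem _ h.d_mem _)), h₄⟩
  have h₆ := sub_mem h₅ h₂
  set l : K := ((tpow (E.h k) (E.ρ k) : Kˣ) : K) with hl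
  have h₇ : d' - q ^ i • d - (d' - (q * l) ^ i • d) = (q ^ i * (l ^ i - 1)) • d := by
    rw [mul_sub, mul_one, sub_smul, mul_pow]
    abel
  have h₈ : q ^ i * (l ^ i - 1) ≠ 0 := by
    refine mul_ne_zero (pow_ne_zero _ hq0) (sub_ne_zero.mpr fun h' => hroot (Units.ext ?_))
    rw [Units.val_pow_eq_pow_val, ← hl, h', Units.val_one]
  rw [h₇, Submodule.smul_mem_iff _ h₈] at h₆
  obtain ⟨e, he, h₉⟩ := mem_yIdeal.mp h₆
  obtain ⟨e', he', h₁₀⟩ := h.y_norm.1 e he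
  exact h.not_dvd hyp hvp hE ⟨e', he', h₉.trans h₁₀⟩

end SkewPair

end CGLData

/-! ### Homogeneous normal elements -/

section Normalizes

variable {K : Type*} [Field K] {R : Type*} [Ring R] [Algebra K R] {S : Subalgebra K R} {u v : R}

theorem normalizes_algebraMap (c : K) : Normalizes S (algebraMap K R c) :=
  ⟨fun a ha => ⟨a, ha, Algebra.commutes c a⟩, fun a ha => ⟨a, ha, (Algebra.commutes c a).symm⟩⟩

theorem normalizes_list_prod {ι : Type*} {z : ι → R} {l : List ι}
    (h : ∀ i ∈ l, Normalizes S (z i)) : Normalizes S (l.map z).prod := by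
  induction l with
  | nil => exact normalizes_one
  | cons i l ih =>
    rw [List.map_cons, List.prod_cons]
    exact (h i List.mem_cons_self).mul (ih fun j hj => h j (List.mem_cons_of_mem i hj))

variable [NoZeroDivisors R] [Nontrivial R]

theorem Normalizes.of_smul {c : K} (hc : c ≠ 0) (h : Normalizes S (c • u)) : Normalizes S u := by
  rw [Algebra.smul_def] at h
  exact (normalizes_algebraMap c).of_mul_left (by simpa using hc) h

theorem Normalizes.of_list_prod {ι : Type*} {z : ι → R} {l : List ι} (hl : l.Nodup) {i : ι}
    (hi : i ∈ l) (h : ∀ j ∈ l, j ≠ i → Normalizes S (z j)) (h0 : ∀ j, z j ≠ 0)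
    (hp : Normalizes S (l.map z).prod) : Normalizes S (z i) := by
  induction l with
  | nil => simp at hi
  | cons a l ih =>
    rw [List.map_cons, List.prod_cons] at hp
    rw [List.nodup_cons] at hl
    by_cases hai : a = i
    · subst hai
      refine (normalizes_list_prod fun j hj => ?_).of_mul_right (List.prod_ne_zero ?_) hp
      · exact h j (List.mem_cons_of_mem _ hj) fun h' => hl.1 (h' ▸ hj)
      · rw [List.mem_map]
        rintro ⟨j, -, hj⟩
        exact h0 j hj
    · exact ih hl.2 ((List.mem_cons.mp hi).resolve_left (Ne.symm hai))
        (fun j hj => h j (List.mem_cons_of_mem _ hj))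
        ((h a List.mem_cons_self hai).of_mul_left (h0 a) hp)

end Normalizes

section Levels

variable {N n : ℕ} {μ : Fin N → Fin n} {i j k : Fin N}

theorem IsLastBelow.eq {l : ℕ} (hi : IsLastBelow μ l i) (hj : IsLastBelow μ l j)
    (h : μ i = μ j) : i = j := by
  rcases lt_trichotomy i j with hlt | heq | hlt
  · exact absurd h.symm (hi.2 j hlt hj.1)
  · exact heq
  · exact absurd h (hj.2 i hlt hi.1)

theorem IsLastBelow.succ (hj : IsLastBelow μ k j) (h : μ k ≠ μ j) : IsLastBelow μ (k + 1) j := by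
  refine ⟨hj.1.trans (Nat.lt_succ_self _), fun j' h₁ h₂ => ?_⟩
  rcases Nat.lt_succ_iff_lt_or_eq.mp h₂ with h₃ | h₃
  · exact hj.2 j' h₁ h₃
  · rwa [Fin.ext h₃]

end Levels

namespace CGLData

variable {K : Type*} [Field K] {R : Type*} [Ring R] [Algebra K R] {N r : ℕ}
  {E : CGLData K R N r} {a b u : R} {m : Fin r → ℤ} {n : ℕ} {μ : Fin N → Fin n} {d y : Fin N → R}

theorem StructData.skewPair_of_pInf (hE : E.IsCGL) (hs : E.StructData μ d y) {k : Fin N}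
    (h : PInf μ k) : E.SkewPair k 1 0 0 ∧ y k = 1 * E.x k - 0 := by
  have := hE.nontrivial
  have hy : y k = 1 * E.x k - 0 := by rw [hs.2.1 k h, one_mul, sub_zero]
  refine ⟨⟨one_mem _, one_ne_zero, one_mem_A, normalizes_one, zero_mem _, ?_, ?_, 1,
    one_ne_zero, by simp⟩, hy⟩
  · simpa using hE.xhom k
  · rw [← hy]
    exact hs.normalizes k.2 (isLastBelow_succ k)

theorem StructData.skewPair_of_isPred (hE : E.IsCGL) (hs : E.StructData μ d y) {j k : Fin N}
    (h : IsPred μ j k) : (∃ η, E.SkewPair k (y j) (d k) η) ∧ y k = y j * E.x k - d k := by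
  obtain ⟨hd, hy⟩ := hs.2.2.1 k j h
  refine ⟨?_, hy⟩
  obtain ⟨η, hη⟩ := hs.2.2.2.1 j
  obtain ⟨ν, hν⟩ := hs.2.2.2.1 k
  have hk0 := hs.ne_zero hE k
  have hkn := hs.normalizes k.2 (isLastBelow_succ k)
  have hym : y j ∈ E.sub (k : ℕ) := hs.mem_sub hE h.1
  have hdeg : ν = η + E.ρ k := by
    by_contra hne
    have h₁ := proj_of_mem_ne hν hne
    rw [hy, map_sub, proj_of_mem (mul_mem_A hη (hE.xhom k))] at h₁
    refine hs.ne_zero hE j (hE.coeff_x_eq_zero (k := k)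
      (neg_mem (proj_mem_sub (m := η + E.ρ k) hE k.2.le hd)) hym ?_).2
    rw [← h₁]
    abel
  refine ⟨η, hym, hs.ne_zero hE j, hη, hs.normalizes k.2.le h.isLastBelow, hd, ?_, ?_, ?_⟩
  · rwa [← hy, ← hdeg]
  · rwa [← hy]
  · rw [← hy]
    exact hs.exists_mul_eq_smul hE k.2.le h.isLastBelow hk0
      (hE.normalizes_mono (Nat.le_succ _) k.2.le hk0 hkn)

/-- A homogeneous normal element of `R_{k+1}` is the product of an element of `R_k` and a power
of `y_k`. -/
theorem StructData.exists_eq_mul_pow (hE : E.IsCGL) (hs : E.StructData μ d y) {k : Fin N}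
    (hu : u ∈ E.sub ((k : ℕ) + 1)) (hm : u ∈ E.A m) (hu0 : u ≠ 0)
    (hun : Normalizes (E.sub ((k : ℕ) + 1)) u) :
    ∃ b ∈ E.sub (k : ℕ), ∃ i : ℕ, u = b * y k ^ i := by
  obtain ⟨c', -, hv⟩ := hs.exists_mul_eq_smul hE k.2 (isLastBelow_succ k) hu0 hun
  rcases pInf_or_exists_isPred μ k with h | ⟨j, h⟩
  · obtain ⟨hp, hy⟩ := hs.skewPair_of_pInf hE h
    rw [hy] at hv ⊢
    obtain ⟨M, b, hb, -, i, hi⟩ := hp.exists_pow_mul_eq hE hu0 hu hm (c := 1) one_ne_zero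
      (by simp) hv
    exact ⟨b, hb, i, by rw [← hi, one_pow, one_mul]⟩
  · obtain ⟨⟨η, hp⟩, hy⟩ := hs.skewPair_of_isPred hE h
    obtain ⟨c, hc, hyu⟩ := hs.exists_mul_eq_smul hE k.2.le h.isLastBelow hu0
      (hE.normalizes_mono (Nat.le_succ _) k.2.le hu0 hun)
    have hvp := (hs.isHomogPrimeIn k.2 (isLastBelow_succ k)).1
    rw [hy] at hv hvp ⊢
    obtain ⟨M, b, hb, -, i, hi⟩ := hp.exists_pow_mul_eq hE hu0 hu hm hc hyu hv
    obtain ⟨b', hb', h'⟩ := hp.exists_eq_of_pow_mul_eq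
      (hs.isHomogPrimeIn k.2.le h.isLastBelow).1 hvp hE hb hi
    exact ⟨b', hb', i, h'⟩

/-- The homogeneous normal elements of `R_k` are the scalar multiples of the monomials in
its homogeneous prime elements. -/
theorem StructData.exists_eq_smul_xmon (hE : E.IsCGL) (hs : E.StructData μ d y) {k : ℕ}
    (hk : k ≤ N) (hu : u ∈ E.sub k) (hm : u ∈ E.A m) (hu0 : u ≠ 0)
    (hun : Normalizes (E.sub k) u) :
    ∃ c : K, c ≠ 0 ∧ ∃ f : Fin N → ℕ, (∀ j, f j ≠ 0 → IsLastBelow μ k j) ∧ u = c • xmon y f := by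
  have := hE.noZeroDivisors
  have := hE.nontrivial
  induction k generalizing u m with
  | zero =>
    have h0 : {y : R | ∃ j : Fin N, (j : ℕ) < 0 ∧ y = E.x j} = ∅ := by simp
    rw [sub, h0, Algebra.adjoin_empty, Algebra.mem_bot] at hu
    obtain ⟨c, rfl⟩ := hu
    refine ⟨c, fun hc => hu0 (by rw [hc, map_zero]), 0, fun j hj => absurd rfl hj, ?_⟩
    rw [xmon_zero, Algebra.algebraMap_eq_smul_one]
  | succ k ih =>
    let k' : Fin N := ⟨k, hk⟩
    obtain ⟨b, hb, i, rfl⟩ := hs.exists_eq_mul_pow (k := k') hE hu hm hu0 hun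
    obtain ⟨ν, hν⟩ := hs.2.2.2.1 k'
    have hvn : Normalizes (E.sub (k + 1)) (y k' ^ i) :=
      (hs.normalizes hk (isLastBelow_succ k')).pow i
    have hv0 : y k' ^ i ≠ 0 := pow_ne_zero _ (hs.ne_zero hE k')
    have hb0 : b ≠ 0 := left_ne_zero_of_mul hu0
    have hbn := hvn.of_mul_right hv0 hun
    obtain ⟨c, hc, f, hf, rfl⟩ := ih (by omega) hb (mem_A_of_mul_right (pow_mem_A hν i) hv0 hm)
      hb0 (hE.normalizes_mono (Nat.le_succ _) (by omega) hb0 hbn)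
    have hfk : ∀ j : Fin N, (k' : ℕ) ≤ j → f j = 0 := fun j hj => by
      by_contra h
      exact absurd (hf j h).1 (not_lt.mpr hj)
    refine ⟨c, hc, Function.update f k' i, fun j hj => ?_, ?_⟩
    · by_cases hjk : j = k'
      · subst hjk
        exact isLastBelow_succ k'
      rw [Function.update_of_ne hjk] at hj
      refine (hf j hj).succ (k := k') fun hμ => ?_
      rcases pInf_or_exists_isPred μ k' with h | ⟨j₀, h⟩
      · exact h j (hf j hj).1 hμ.symm
      have hj₀ : ∀ j', f j' ≠ 0 → μ k' = μ j' → j' = j₀ := fun j' hj' h' =>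
        (hf j' hj').eq h.isLastBelow (h'.symm.trans h.2.1.symm)
      obtain rfl := hj₀ j hj hμ
      obtain ⟨⟨η, hp⟩, hy⟩ := hs.skewPair_of_isPred hE h
      have hvp := (hs.isHomogPrimeIn hk (isLastBelow_succ k')).1
      rw [hy] at hvp
      refine hp.not_normalizes_pow (hs.isHomogPrimeIn k'.2.le h.isLastBelow).1 hvp hE
        (Nat.one_le_iff_ne_zero.mpr hj) ?_
      refine Normalizes.of_list_prod (z := fun i => y i ^ f i) (List.nodup_finRange N)
        (List.mem_finRange j) (fun j' _ hj' => ?_) (fun j' => pow_ne_zero _ (hs.ne_zero hE j'))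
        (hbn.of_smul hc)
      by_cases h0 : f j' = 0
      · simp only [h0, pow_zero]
        exact normalizes_one
      · exact (hs.normalizes hk ((hf j' h0).succ fun h' => hj' (hj₀ j' h0 h'))).pow _
    · rw [smul_mul_assoc, xmon_mul_pow y k' f hfk]

end CGLData

/-! ### The normal subalgebra -/

namespace CGLData

section NormalSubalgebra

variable {K : Type*} [Field K] {R : Type*} [Ring R] [Algebra K R] {N r : ℕ}
  {E : CGLData K R N r} {n : ℕ} {μ : Fin N → Fin n} {d y : Fin N → R} {u : R}

theorem normalizes_proj [NoZeroDivisors R] (hu : Normalizes (⊤ : Subalgebra K R) u) (hu0 : u ≠ 0)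
    (m : Fin r → ℤ) : Normalizes (⊤ : Subalgebra K R) (E.proj m u) := by
  constructor
  · intro a _
    choose b _ hb using fun a => hu.1 a trivial
    obtain ⟨s, -, hs⟩ := E.exists_sum_proj a
    refine ⟨∑ m' ∈ s, b (E.proj m' a), trivial, ?_⟩
    conv_lhs => rw [hs]
    rw [Finset.mul_sum, Finset.sum_mul]
    refine Finset.sum_congr rfl fun m' _ => ?_
    have hb' : b (E.proj m' a) ∈ E.A m' := mem_A_of_intertwine hu0 (proj_mem a) (.inl (hb _))
    rw [← proj_mul_right (proj_mem a), hb, add_comm, proj_mul_left hb']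
  · intro a _
    choose b _ hb using fun a => hu.2 a trivial
    obtain ⟨s, -, hs⟩ := E.exists_sum_proj a
    refine ⟨∑ m' ∈ s, b (E.proj m' a), trivial, ?_⟩
    conv_lhs => rw [hs]
    rw [Finset.mul_sum, Finset.sum_mul]
    refine Finset.sum_congr rfl fun m' _ => ?_
    have hb' : b (E.proj m' a) ∈ E.A m' := mem_A_of_intertwine hu0 (proj_mem a) (.inr (hb _))
    rw [← proj_mul_left (proj_mem a), hb, add_comm, proj_mul_right hb']

theorem StructData.isNormalElem (hE : E.IsCGL) (hs : E.StructData μ d y) {j : Fin N}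
    (hj : SInf μ j) : IsNormalElem (y j) := by
  rw [isNormalElem_iff K, ← hE.sub_eq_top]
  exact hs.normalizes le_rfl (isLastBelow_iff_sInf.mpr hj)

theorem StructData.mem_span_of_isNormalElem (hE : E.IsCGL) (hs : E.StructData μ d y)
    (hu : IsNormalElem u) : u ∈ Submodule.span K (xmon y '' {f | ∀ j, f j ≠ 0 → SInf μ j}) := by
  have := hE.noZeroDivisors
  rcases eq_or_ne u 0 with rfl | hu0
  · exact zero_mem _
  rw [isNormalElem_iff K] at hu
  obtain ⟨s, hs', h⟩ := E.exists_sum_proj u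
  rw [h]
  refine sum_mem fun m hm => ?_
  have hp := normalizes_proj (E := E) hu hu0 m
  rw [← hE.sub_eq_top] at hp
  obtain ⟨c, _, f, hf, hc⟩ := hs.exists_eq_smul_xmon hE le_rfl
    (by rw [hE.sub_eq_top]; trivial) (proj_mem u) ((hs' m).mp hm) hp
  rw [hc]
  exact Submodule.smul_mem _ _ (Submodule.subset_span
    ⟨f, fun j hj => isLastBelow_iff_sInf.mp (hf j hj), rfl⟩)

/-- The normal subalgebra is spanned by the monomials in the homogeneous primes of `R`. -/
theorem StructData.toSubmodule_adjoin_normal (hE : E.IsCGL) (hs : E.StructData μ d y) :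
    Subalgebra.toSubmodule (Algebra.adjoin K {u : R | IsNormalElem u})
      = Submodule.span K (xmon y '' {f | ∀ j, f j ≠ 0 → SInf μ j}) := by
  apply le_antisymm
  · rw [Algebra.adjoin_eq_span, Submodule.span_le]
    intro u hu
    refine hs.mem_span_of_isNormalElem hE ?_
    induction hu using Submonoid.closure_induction with
    | mem u hu => exact hu
    | one => exact (isNormalElem_iff K).mpr normalizes_one
    | mul u v _ _ hu hv =>
      rw [isNormalElem_iff K] at hu hv ⊢
      exact hu.mul hv
  · rw [Submodule.span_le]
    rintro _ ⟨f, hf, rfl⟩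
    exact xmon_mem (Algebra.adjoin K {u : R | IsNormalElem u}) y f
      fun j hj => Algebra.subset_adjoin (hs.isNormalElem hE (hf j hj))

end NormalSubalgebra

end CGLData

/-! ### Leading exponents of normal elements -/

section PrimeExp

variable {N n : ℕ} {μ : Fin N → Fin n} {i j : Fin N}

theorem exists_sInf (hμ : Function.Surjective μ) (i : Fin n) : ∃ j, μ j = i ∧ SInf μ j := by
  obtain ⟨k, hk⟩ := hμ i
  have hs : (Finset.univ.filter fun j => μ j = i).Nonempty := ⟨k, by simpa using hk⟩
  have hm : μ (Finset.max' _ hs) = i := by simpa using Finset.max'_mem _ hs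
  refine ⟨Finset.max' _ hs, hm, fun j hj hμj => not_le.mpr hj (Finset.le_max' _ j ?_)⟩
  simpa using hμj.trans hm

theorem SInf.le (hj : SInf μ j) (h : μ i = μ j) : i ≤ j :=
  not_lt.mp fun hij => hj i hij h

theorem SInf.eq (hi : SInf μ i) (hj : SInf μ j) (h : μ i = μ j) : i = j :=
  le_antisymm (hj.le h) (hi.le h.symm)

open Classical in
/-- The exponent `∑ mᵢ eⱼ`, where `j` is the last index in the level set of `i`. -/
noncomputable def lastExp (μ : Fin N → Fin n) (m : Fin n → ℕ) : Fin N → ℕ :=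
  fun j => if SInf μ j then m (μ j) else 0

theorem sInf_of_lastExp_ne_zero {m : Fin n → ℕ} (h : lastExp μ m j ≠ 0) : SInf μ j := by
  by_contra hj
  exact h (if_neg hj)

theorem exists_eq_lastExp (hμ : Function.Surjective μ) {f : Fin N → ℕ}
    (hf : ∀ j, f j ≠ 0 → SInf μ j) : ∃ m, f = lastExp μ m := by
  choose l hl hl' using exists_sInf hμ
  refine ⟨fun i => f (l i), funext fun j => ?_⟩
  by_cases hj : SInf μ j
  · rw [lastExp, if_pos hj, (hl' (μ j)).eq hj (hl (μ j))]
  · rw [lastExp, if_neg hj]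
    by_contra h
    exact hj (hf j h)

theorem sum_lastExp_smul_levelExp (hμ : Function.Surjective μ) (m : Fin n → ℕ) :
    ∑ j, lastExp μ m j • levelExp μ j = m ∘ μ := by
  ext i
  obtain ⟨j, hj, hj'⟩ := exists_sInf hμ (μ i)
  rw [Finset.sum_apply, Finset.sum_eq_single j]
  · simp [lastExp, levelExp, hj, hj', hj'.le hj.symm]
  · intro k _ hkj
    rw [Pi.smul_apply, smul_eq_mul, mul_eq_zero]
    by_contra! h
    have hk := sInf_of_lastExp_ne_zero h.1
    have hi : μ i = μ k := by
      by_contra hne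
      exact h.2 (if_neg fun h' => hne h'.2)
    exact hkj (hk.eq hj' (hi.symm.trans hj.symm))
  · simp

/-- Every exponent is the sum of one constant on the level sets and one vanishing somewhere on
each of them. -/
theorem exists_eq_comp_add (hμ : Function.Surjective μ) (f : Fin N → ℕ) :
    ∃ (m : Fin n → ℕ) (g : Fin N → ℕ), (∀ i, ∃ k, μ k = i ∧ g k = 0) ∧ f = m ∘ μ + g := by
  have h : ∀ i : Fin n, ∃ k, μ k = i ∧ ∀ j, μ j = i → f k ≤ f j := fun i => by
    obtain ⟨k₀, hk₀⟩ := hμ i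
    obtain ⟨k, hk, hmin⟩ := Finset.exists_min_image (Finset.univ.filter fun j => μ j = i) f
      ⟨k₀, by simpa using hk₀⟩
    exact ⟨k, by simpa using hk, fun j hj => hmin j (by simpa using hj)⟩
  choose k hk hmin using h
  refine ⟨fun i => f (k i), fun j => f j - f (k (μ j)), fun i => ⟨k i, hk i, ?_⟩,
    funext fun j => ?_⟩
  · simp only [hk, Nat.sub_self]
  · exact (Nat.add_sub_cancel' (hmin _ j rfl)).symm

theorem eq_of_comp_add_eq {m m' : Fin n → ℕ} {g g' : Fin N → ℕ}
    (hg : ∀ i, ∃ k, μ k = i ∧ g k = 0) (hg' : ∀ i, ∃ k, μ k = i ∧ g' k = 0)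
    (h : m ∘ μ + g = m' ∘ μ + g') : g = g' := by
  have hm : m = m' := by
    funext i
    obtain ⟨k, rfl, hk⟩ := hg i
    obtain ⟨k', hμ, hk'⟩ := hg' (μ k)
    have h1 := congrFun h k
    have h2 := congrFun h k'
    simp only [Pi.add_apply, Function.comp_apply, hk, hk', hμ] at h1 h2
    omega
  subst hm
  exact add_left_cancel h

end PrimeExp

namespace CGLData

variable {K : Type*} [Field K] {R : Type*} [Ring R] [Algebra K R] {N r : ℕ}
  {E : CGLData K R N r} {n : ℕ} {μ : Fin N → Fin n} {d y : Fin N → R} {a : R}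

theorem StructData.hasLead_xmon_lastExp (hE : E.IsCGL) (hs : E.StructData μ d y)
    (m : Fin n → ℕ) : HasLead K E.x (xmon y (lastExp μ m)) (m ∘ μ) := by
  rw [← sum_lastExp_smul_levelExp hs.1, Fin.sum_univ_def, xmon]
  induction List.finRange N with
  | nil => simpa [xmon_zero] using hasLead_xmon (K := K) E.x 0
  | cons j l ih =>
    rw [List.map_cons, List.prod_cons, List.map_cons, List.sum_cons]
    exact hE.hasLead_mul (hE.hasLead_pow (hs.hasLead hE j) _) ih

theorem StructData.exists_hasLead_comp (hE : E.IsCGL) (hs : E.StructData μ d y)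
    (ha : a ∈ Algebra.adjoin K {u : R | IsNormalElem u}) (h0 : a ≠ 0) :
    ∃ m : Fin n → ℕ, HasLead K E.x a (m ∘ μ) := by
  have himage : xmon y '' {f | ∀ j, f j ≠ 0 → SInf μ j}
      ⊆ Set.range fun m => xmon y (lastExp μ m) := by
    rintro _ ⟨f, hf, rfl⟩
    obtain ⟨m, rfl⟩ := exists_eq_lastExp hs.1 hf
    exact ⟨m, rfl⟩
  rw [← Subalgebra.mem_toSubmodule, hs.toSubmodule_adjoin_normal hE] at ha
  obtain ⟨c, rfl⟩ := Finsupp.mem_span_range_iff_exists_finsupp.mp (Submodule.span_mono himage ha)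
  have hne : c.support.Nonempty := by
    rw [Finsupp.support_nonempty_iff]
    rintro rfl
    simp at h0
  obtain ⟨m, -, hm⟩ := HasLead.sum (e := fun m => m ∘ μ) hne
    (fun m hm => (hs.hasLead_xmon_lastExp hE m).smul (Finsupp.mem_support_iff.mp hm))
    hs.1.injective_comp_right.injOn
  exact ⟨m, hm⟩

theorem StructData.xmon_lastExp_mem (hE : E.IsCGL) (hs : E.StructData μ d y) (m : Fin n → ℕ) :
    xmon y (lastExp μ m) ∈ Algebra.adjoin K {u : R | IsNormalElem u} :=
  xmon_mem (Algebra.adjoin K {u : R | IsNormalElem u}) y _ fun _ hj =>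
    Algebra.subset_adjoin (hs.isNormalElem hE (sInf_of_lastExp_ne_zero hj))

/-- Freeness over the normal subalgebra, simultaneously for both sides: `T` is the
multiplication of `R` or its opposite. -/
theorem StructData.existsUnique_sum (hE : E.IsCGL) (hs : E.StructData μ d y)
    (T : R →ₗ[K] R →ₗ[K] R)
    (hT : ∀ a b f g, HasLead K E.x a f → HasLead K E.x b g → HasLead K E.x (T a b) (f + g))
    (a : R) :
    ∃! c : {g : Fin N → ℕ // ∀ i : Fin n, ∃ k : Fin N, μ k = i ∧ g k = 0} →₀
        (Algebra.adjoin K {u : R | IsNormalElem u}),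
      a = c.sum fun g v => T (v : R) (xmon E.x g.1) := by
  let B := Algebra.adjoin K {u : R | IsNormalElem u}
  let Φ : ({g : Fin N → ℕ // ∀ i : Fin n, ∃ k : Fin N, μ k = i ∧ g k = 0} →₀ B) →ₗ[K] R :=
    Finsupp.lsum K fun g => T.flip (xmon E.x g.1) ∘ₗ B.val.toLinearMap
  have hΦ : ∀ c, Φ c = c.sum fun g v => T (v : R) (xmon E.x g.1) := fun c => rfl
  have hsurj : LinearMap.range Φ = ⊤ := by
    rw [eq_top_iff, ← hE.span_xmon, Submodule.span_le]
    rintro _ ⟨f, rfl⟩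
    induction f using (ColexLT.wellFounded N).induction with
    | _ f ih =>
      obtain ⟨m, g, hg, rfl⟩ := exists_eq_comp_add hs.1 f
      obtain ⟨c, hc, l, hl, h⟩ :=
        hT _ _ _ _ (hs.hasLead_xmon_lastExp hE m) (hasLead_xmon E.x g)
      have hl' : l ∈ LinearMap.range Φ := by
        refine Submodule.span_le.mpr ?_ hl
        rintro _ ⟨f, hf, rfl⟩
        exact ih f hf
      have hmem : T (xmon y (lastExp μ m)) (xmon E.x g) ∈ LinearMap.range Φ :=
        ⟨Finsupp.single ⟨g, hg⟩ ⟨_, hs.xmon_lastExp_mem hE m⟩, by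
          simp [hΦ, Finsupp.sum_single_index]⟩
      rw [h] at hmem
      exact (Submodule.smul_mem_iff _ hc).mp ((Submodule.add_mem_iff_left _ hl').mp hmem)
  have hinj : Function.Injective Φ := by
    rw [injective_iff_map_eq_zero]
    intro c hc
    by_contra hc0
    have hlead : ∀ g, c g ≠ 0 → ∃ m : Fin n → ℕ, HasLead K E.x (c g : R) (m ∘ μ) := fun g hg =>
      hs.exists_hasLead_comp hE (c g).2 (by simpa using hg)
    choose! m hm using hlead
    obtain ⟨g, -, hg⟩ := HasLead.sum (K := K) (x := E.x)
      (v := fun g => T (c g : R) (xmon E.x g.1)) (e := fun g => m g ∘ μ + g.1)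
      (Finsupp.support_nonempty_iff.mpr hc0)
      (fun g hg => hT _ _ _ _ (hm g (Finsupp.mem_support_iff.mp hg)) (hasLead_xmon E.x g.1))
      (fun g _ g' _ h => Subtype.ext (eq_of_comp_add_eq g.2 g'.2 h))
    exact hg.ne_zero hE.linearIndependent hc
  obtain ⟨c, rfl⟩ := LinearMap.range_eq_top.mp hsurj a
  exact ⟨c, hΦ c, fun c' h => hinj h.symm⟩

end CGLData

/-- **Theorem 4.13 / Corollary 4.14** of Goodearl–Yakimov: a CGL extension `R`
is a free left and a free right module over its normal subalgebra `N(R)`,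
with basis the monomials `x^g` for `g ∈ Δ(R)`; in particular `N(R)` (the
summand for `g = 0 ∈ Δ(R)`) is an `(N(R),N(R))`-bimodule direct summand
of `R`. -/
theorem stmt18 {K : Type*} [Field K] {R : Type*} [Ring R] [Algebra K R]
    {N r : ℕ} (E : CGLData K R N r) (hE : E.IsCGL)
    (n : ℕ)
    (hn : n = Set.ncard {j : Fin N | ∀ b ∈ E.sub (j : ℕ), E.D j b = 0})
    (μ : Fin N → Fin n) (d y : Fin N → R)
    (hstruct : E.StructData μ d y) :
    -- `R = ⊕_{g ∈ Δ(R)} N(R)·x^g`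
    (∀ a : R,
      ∃! c : {g : Fin N → ℕ // ∀ i : Fin n, ∃ k : Fin N, μ k = i ∧ g k = 0} →₀
          (Algebra.adjoin K {u : R | IsNormalElem u}),
        a = c.sum fun g v => (v : R) * xmon E.x g.1) ∧
    -- `R = ⊕_{g ∈ Δ(R)} x^g·N(R)`
    (∀ a : R,
      ∃! c : {g : Fin N → ℕ // ∀ i : Fin n, ∃ k : Fin N, μ k = i ∧ g k = 0} →₀
          (Algebra.adjoin K {u : R | IsNormalElem u}),
        a = c.sum fun g v => xmon E.x g.1 * (v : R)) := by
  refine ⟨fun a =>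
      hstruct.existsUnique_sum hE (LinearMap.mul K R) (fun _ _ _ _ => hE.hasLead_mul) a,
    fun a => hstruct.existsUnique_sum hE (LinearMap.mul K R).flip (fun _ _ f g ha hb => ?_) a⟩
  rw [add_comm]
  exact hE.hasLead_mul hb ha
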